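/- arXiv:1604.00663 — 2 statements merged into one kernel-verified Lean document; each statement's English description precedes it below -/
import Mathlib

section
/- For every n ≥ 1, the tenth central moment of the Gepner statistic over W(n,n,n) equals n¹³(3n − 4)(68985n⁶ − 469716n⁵ + 1391760n⁴ − 2251584n³ + 2072832n² − 1022208n + 209920)/11264; that is, (1/|W(n,n,n)|) Σ_{w ∈ W(n,n,n)} (gep(w) − n³/2)¹⁰ equals this polynomial expression (as an identity in ℚ). -/
/-- The Gepner statistic of a word `w` over a totally ordered alphabet:
the number of triples of positions `i < j < k` such that `w_i w_j w_k`
reduces to one of the odd permutations `132`, `213`, `321`. -/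
def gep {α : Type*} [LinearOrder α] (w : List α) : ℕ :=
  (Finset.univ.filter (fun t : Fin w.length × Fin w.length × Fin w.length =>
    t.1 < t.2.1 ∧ t.2.1 < t.2.2 ∧
      ((w.get t.1 < w.get t.2.2 ∧ w.get t.2.2 < w.get t.2.1) ∨
       (w.get t.2.1 < w.get t.1 ∧ w.get t.1 < w.get t.2.2) ∨
       (w.get t.2.2 < w.get t.2.1 ∧ w.get t.2.1 < w.get t.1)))).card

/-- `W a1 a2 a3` is the (finite) set of words over the alphabet `{1,2,3}`
with exactly `a1` occurrences of `1`, `a2` occurrences of `2` and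
`a3` occurrences of `3`. -/
def W (a1 a2 a3 : ℕ) : Finset (List ℕ) :=
  ((List.replicate a1 1 ++ List.replicate a2 2 ++ List.replicate a3 3).permutations).toFinset

set_option linter.unusedVariables false
set_option maxHeartbeats 4000000
set_option maxRecDepth 100000

/-- First elementary symmetric function. -/
def e1 (a b c : ℤ) : ℤ := a + b + c

/-- Second elementary symmetric function. -/
def e2 (a b c : ℤ) : ℤ := a * b + b * c + c * a

/-- Third elementary symmetric function. -/
def e3 (a b c : ℤ) : ℤ := a * b * c

lemma e1_rot (a b c : ℤ) : e1 b c a = e1 a b c := by unfold e1; ring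

lemma e2_rot (a b c : ℤ) : e2 b c a = e2 a b c := by unfold e2; ring

lemma e3_rot (a b c : ℤ) : e3 b c a = e3 a b c := by unfold e3; ring

lemma psum2 (a b c : ℤ) : e1 a b c ^ 2 - 2 * e2 a b c = a ^ 2 + b ^ 2 + c ^ 2 := by
  unfold e1 e2; ring

lemma aux_d (a b c : ℤ) : (e1 a b c - a) ^ 2 - 4 * (b * c) = (b - c) ^ 2 := by unfold e1; ring

lemma aux_x1 (a b c : ℤ) : e1 a b c - 1 = e1 (a - 1) b c := by unfold e1; ring

lemma aux_y (a b c : ℤ) : a * (e1 a b c - a) + b * c = e2 a b c := by unfold e1 e2; ring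

lemma aux_y1 (a b c : ℤ) :
    a * (e1 a b c - a) + b * c - (e1 a b c - a) = e2 (a - 1) b c := by unfold e1 e2; ring

lemma aux_z (a b c : ℤ) : a * (b * c) = e3 a b c := by unfold e3; ring

lemma aux_z1 (a b c : ℤ) : a * (b * c) - b * c = e3 (a - 1) b c := by unfold e3; ring

/-- The moment polynomial of order 2 (times 3), in the elementary symmetric functions. -/
def mom2 (x y z : ℤ) : ℤ :=
  ((((-9)))) * z
  + ((((1) * x + 1)) * y)

/-- The moment polynomial of order 4 (times 15), in the elementary symmetric functions. -/
def mom4 (x y z : ℤ) : ℤ :=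
  ((((405))) * z
  + (((((-90)) * x + (-252))) * y
    + (((66) * x + 36) * x + (-30)))) * z
  + ((((((5) * x + 12) * x + 7)) * y
    + (((((-2)) * x + (-4)) * x + (-2)) * x)) * y)

/-- The moment polynomial of order 6 (times 63), in the elementary symmetric functions. -/
def mom6 (x y z : ℤ) : ℤ :=
  ((((((-25515)))) * z
  + ((((8505) * x + 39123)) * y
    + ((((-12474)) * x + (-2916)) * x + 3726))) * z
  + (((((((-945)) * x + (-5670)) * x + (-16389))) * y
    + ((((1764) * x + 9666) * x + 6552) * x + (-7182))) * y
    + ((((((-1168)) * x + (-2160)) * x + 1624) * x + 1536) * x + (-1080)))) * z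
  + ((((((((35) * x + 147) * x + 205) * x + 93)) * y
    + ((((((-42)) * x + (-158)) * x + (-198)) * x + (-82)) * x)) * y
    + (((((16) * x + 48) * x + 40) * x ^ 2 + (-8)) * x)) * y)

/-- The moment polynomial of order 8 (times 135), in the elementary symmetric functions. -/
def mom8 (x y z : ℤ) : ℤ :=
  ((((((1148175))) * z
  + (((((-510300)) * x + (-3265920))) * y
    + (((1122660) * x + (-87480)) * x + 154548))) * z
  + ((((((85050) * x + 816480) * x + 3382074)) * y
    + (((((-283500)) * x + (-2043144)) * x + (-867996)) * x + 996624)) * y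
    + (((((301716) * x + 304560) * x + (-416520)) * x + 147312) * x + (-63180)))) * z
  + (((((((((-6300)) * x + (-60480)) * x + (-351828)) * x + (-1242432))) * y
    + (((((21420) * x + 218232) * x + 1070136) * x + 927864) * x + (-1205172))) * y
    + (((((((-31784)) * x + (-277424)) * x + (-533104)) * x + 359648) * x + 750360) * x + (-526608))) * y
    + (((((((18576) * x + 77376) * x + 3744) * x + (-215040)) * x + 76464) * x + 147456) * x + (-88992)))) * z
  + ((((((((((175) * x + 1120) * x + 2714) * x + 2912) * x + 1143)) * y
    + (((((((-420)) * x + (-2488)) * x + (-5584)) * x + (-5576)) * x + (-2060)) * x)) * y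
    + (((((((404) * x + 2048) * x + 3704) * x + 2480) * x + (-76)) * x + (-496)) * x)) * y
    + (((((((-144)) * x + (-576)) * x + (-672)) * x ^ 2 + 336) * x ^ 2 + (-96)) * x)) * y)

/-- The moment polynomial of order 10 (times 99), in the elementary symmetric functions. -/
def mom10 (x y z : ℤ) : ℤ :=
  ((((((((-22733865)))) * z
  + ((((12629925) * x + 103565385)) * y
    + ((((-37047780)) * x + 14434200) * x + (-31659012)))) * z
  + (((((((-2806650)) * x + (-37047780)) * x + (-192728646))) * y
    + ((((13471920) * x + 118392516) * x + 18283320) * x + 21068100)) * y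
    + ((((((-19463004)) * x + (-5260464)) * x + 8235432) * x + (-43386192)) * x + 47611476))) * z
  + ((((((((311850) * x + 4677750) * x + 39066786) * x + 169804998)) * y
    + ((((((-1746360)) * x + (-24709212)) * x + (-146740572)) * x + (-97615044)) * x + 103634964)) * y
    + ((((((4010292) * x + 40935708) * x + 56546712) * x + (-49098888)) * x + (-18841356)) * x + (-1139508))) * y
    + ((((((((-3534960)) * x + (-9023616)) * x + 6601344) * x + 10699776) * x + (-21932688)) * x + 31237056) * x + (-16244928)))) * z
  + (((((((((((-17325)) * x + (-235620)) * x + (-2075634)) * x + (-14490828)) * x + (-57983121))) * y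
    + ((((((92400) * x + 1381644) * x + 12388992) * x + 65399688) * x + 69430992) * x + (-98243028))) * y
    + ((((((((-229460)) * x + (-3435432)) * x + (-25210232)) * x + (-56256672)) * x + 33529900) * x + 117499752) * x + (-86331456))) * y
    + ((((((((293216) * x + 3797296) * x + 14554560) * x + 4562528) * x + (-52909664)) * x + (-176880)) * x + 73106304) * x + (-41162976))) * y
    + ((((((((((-154368)) * x + (-1174272)) * x + (-1861248)) * x + 5627904) * x + 7138560) * x + (-18690048)) * x + 2343168) * x + 14155776) * x + (-7546752)))) * z
  + ((((((((((((385) * x + 3465) * x + 12694) * x + 23430) * x + 21481) * x + 7665)) * y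
    + ((((((((-1540)) * x + (-13068)) * x + (-45144)) * x + (-78728)) * x + (-68516)) * x + (-23404)) * x)) * y
    + ((((((((2684) * x + 20284) * x + 60728) * x + 86520) * x + 50572) * x + (-3124)) * x + (-10304)) * x)) * y
    + ((((((((((-2288)) * x + (-14512)) * x + (-33856)) * x + (-30304)) * x + 2288) * x + 15152) * x + (-704)) * x + (-4896)) * x)) * y
    + (((((((768) * x + 3840) * x + 5760) * x ^ 2 + (-5376)) * x ^ 2 + 3840) * x ^ 2 + (-1152)) * x)) * y)

/-- Coefficient polynomial in the one-letter contribution to the moment of order 2. -/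
def coA2 (x y z : ℤ) : ℤ :=
  0

/-- Coefficient polynomial in the one-letter contribution to the moment of order 2. -/
def coB2 (x y z : ℤ) : ℤ :=
  ((((-9)))) * z
  + ((((1) * x + (-3))) * y
    + ((2) * x ^ 2))

/-- Coefficient polynomial in the one-letter contribution to the moment of order 2. -/
def coC2 (x y z : ℤ) : ℤ :=
  ((((-2)) * x))

lemma one_letter2 (a x t : ℤ) :
    a * (3 * ((x - a) ^ 2 - 4 * t) ^ 1
      + 1 * mom2 (x - 1) (a * (x - a) + t - (x - a)) (a * t - t)) =
    coA2 x (a * (x - a) + t) (a * t) + coB2 x (a * (x - a) + t) (a * t) * a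
      + coC2 x (a * (x - a) + t) (a * t) * a ^ 2 := by
  simp only [mom2, coA2, coB2, coC2]
  ring

lemma sum_letters2 (x y z : ℤ) :
    1 * x * mom2 x y z = 3 * coA2 x y z + coB2 x y z * x + coC2 x y z * (x ^ 2 - 2 * y) := by
  simp only [mom2, coA2, coB2, coC2]
  ring

/-- The one-letter contribution to the moment of order 2. -/
def step2 (a b c : ℤ) : ℤ :=
  3 * (b - c) ^ 2
  + 1 * mom2 (e1 (a - 1) b c) (e2 (a - 1) b c) (e3 (a - 1) b c)

lemma step2_eq (a b c : ℤ) : a * step2 a b c =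
    coA2 (e1 a b c) (e2 a b c) (e3 a b c) + coB2 (e1 a b c) (e2 a b c) (e3 a b c) * a
      + coC2 (e1 a b c) (e2 a b c) (e3 a b c) * a ^ 2 := by
  have h := one_letter2 a (e1 a b c) (b * c)
  rw [aux_d, aux_y1, aux_z1, aux_x1, aux_y, aux_z] at h
  simpa only [step2, ← pow_mul, Nat.reduceMul] using h

lemma mom2_rec (a b c : ℤ) : 1 * e1 a b c * mom2 (e1 a b c) (e2 a b c) (e3 a b c) =
    a * step2 a b c + b * step2 b c a + c * step2 c a b := by
  rw [sum_letters2, step2_eq, step2_eq, step2_eq, e1_rot b c a, e2_rot b c a, e3_rot b c a,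
    e1_rot a b c, e2_rot a b c, e3_rot a b c, psum2]
  simp only [e1]
  ring

/-- Coefficient polynomial in the one-letter contribution to the moment of order 4. -/
def coA4 (x y z : ℤ) : ℤ :=
  (((((-288))) * y
    + (((104) * x + (-64)) * x))) * z

/-- Coefficient polynomial in the one-letter contribution to the moment of order 4. -/
def coB4 (x y z : ℤ) : ℤ :=
  ((((405))) * z
  + (((((-90)) * x + 108)) * y
    + ((((-114)) * x + 156) * x + 162))) * z
  + ((((((5) * x + (-28)) * x + 15)) * y
    + ((((18) * x + 8) * x + (-2)) * x)) * y
    + (((-8)) * x ^ 4))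

/-- Coefficient polynomial in the one-letter contribution to the moment of order 4. -/
def coC4 (x y z : ℤ) : ℤ :=
  ((((180) * x + (-432)))) * z
  + ((((((-20)) * x + 4) * x)) * y
    + ((8) * x ^ 3))

lemma one_letter4 (a x t : ℤ) :
    a * (15 * ((x - a) ^ 2 - 4 * t) ^ 2
      + 30 * ((x - a) ^ 2 - 4 * t) ^ 1 * mom2 (x - 1) (a * (x - a) + t - (x - a)) (a * t - t)
      + 1 * mom4 (x - 1) (a * (x - a) + t - (x - a)) (a * t - t)) =
    coA4 x (a * (x - a) + t) (a * t) + coB4 x (a * (x - a) + t) (a * t) * a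
      + coC4 x (a * (x - a) + t) (a * t) * a ^ 2 := by
  simp only [mom2, mom4, coA4, coB4, coC4]
  ring

lemma sum_letters4 (x y z : ℤ) :
    1 * x * mom4 x y z = 3 * coA4 x y z + coB4 x y z * x + coC4 x y z * (x ^ 2 - 2 * y) := by
  simp only [mom4, coA4, coB4, coC4]
  ring

/-- The one-letter contribution to the moment of order 4. -/
def step4 (a b c : ℤ) : ℤ :=
  15 * (b - c) ^ 4
  + 30 * (b - c) ^ 2 * mom2 (e1 (a - 1) b c) (e2 (a - 1) b c) (e3 (a - 1) b c)
  + 1 * mom4 (e1 (a - 1) b c) (e2 (a - 1) b c) (e3 (a - 1) b c)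

lemma step4_eq (a b c : ℤ) : a * step4 a b c =
    coA4 (e1 a b c) (e2 a b c) (e3 a b c) + coB4 (e1 a b c) (e2 a b c) (e3 a b c) * a
      + coC4 (e1 a b c) (e2 a b c) (e3 a b c) * a ^ 2 := by
  have h := one_letter4 a (e1 a b c) (b * c)
  rw [aux_d, aux_y1, aux_z1, aux_x1, aux_y, aux_z] at h
  simpa only [step4, ← pow_mul, Nat.reduceMul] using h

lemma mom4_rec (a b c : ℤ) : 1 * e1 a b c * mom4 (e1 a b c) (e2 a b c) (e3 a b c) =
    a * step4 a b c + b * step4 b c a + c * step4 c a b := by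
  rw [sum_letters4, step4_eq, step4_eq, step4_eq, e1_rot b c a, e2_rot b c a, e3_rot b c a,
    e1_rot a b c, e2_rot a b c, e3_rot a b c, psum2]
  simp only [e1]
  ring

/-- Coefficient polynomial in the one-letter contribution to the moment of order 6. -/
def coA6 (x y z : ℤ) : ℤ :=
  (((((272160)) * y
    + ((((-98280)) * x + 112320) * x))) * z
  + ((((((-30240)) * x + (-168480))) * y
    + ((((10920) * x + 89640) * x + (-39360)) * x)) * y
    + ((((((-14880)) * x + 7680) * x + 15360) * x + (-11520)) * x))) * z

/-- Coefficient polynomial in the one-letter contribution to the moment of order 6. -/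
def coB6 (x y z : ℤ) : ℤ :=
  ((((((-127575)))) * z
  + ((((42525) * x + 25515)) * y
    + (((22680) * x + (-127980)) * x + (-318330)))) * z
  + (((((((-4725)) * x + 9450) * x + (-21465))) * y
    + (((((-10080)) * x + (-12150)) * x + 200160) * x + 94770)) * y
    + (((((15580) * x + (-57960)) * x + (-21220)) * x + (-38400)) * x + 29160))) * z
  + ((((((((175) * x + (-1365)) * x + 1025) * x + (-315))) * y
    + (((((840) * x + 1730) * x + (-120)) * x + 430) * x)) * y
    + ((((((-1180)) * x + (-960)) * x + (-220)) * x ^ 2 + (-40)) * x)) * y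
    + ((480) * x ^ 6))

/-- Coefficient polynomial in the one-letter contribution to the moment of order 6. -/
def coC6 (x y z : ℤ) : ℤ :=
  ((((((-85050)) * x + 408240))) * z
  + (((((18900) * x + (-15120)) * x + (-252720))) * y
    + (((((-21420)) * x + 91800) * x + 6300) * x))) * z
  + (((((((-1050)) * x ^ 2 + (-390)) * x)) * y
    + ((((1260) * x + 240) * x + 420) * x ^ 2)) * y
    + (((-480)) * x ^ 5))

lemma one_letter6 (a x t : ℤ) :
    a * (315 * ((x - a) ^ 2 - 4 * t) ^ 3
      + 1575 * ((x - a) ^ 2 - 4 * t) ^ 2 * mom2 (x - 1) (a * (x - a) + t - (x - a)) (a * t - t)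
      + 315 * ((x - a) ^ 2 - 4 * t) ^ 1 * mom4 (x - 1) (a * (x - a) + t - (x - a)) (a * t - t)
      + 5 * mom6 (x - 1) (a * (x - a) + t - (x - a)) (a * t - t)) =
    coA6 x (a * (x - a) + t) (a * t) + coB6 x (a * (x - a) + t) (a * t) * a
      + coC6 x (a * (x - a) + t) (a * t) * a ^ 2 := by
  simp only [mom2, mom4, mom6, coA6, coB6, coC6]
  ring

lemma sum_letters6 (x y z : ℤ) :
    5 * x * mom6 x y z = 3 * coA6 x y z + coB6 x y z * x + coC6 x y z * (x ^ 2 - 2 * y) := by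
  simp only [mom6, coA6, coB6, coC6]
  ring

/-- The one-letter contribution to the moment of order 6. -/
def step6 (a b c : ℤ) : ℤ :=
  315 * (b - c) ^ 6
  + 1575 * (b - c) ^ 4 * mom2 (e1 (a - 1) b c) (e2 (a - 1) b c) (e3 (a - 1) b c)
  + 315 * (b - c) ^ 2 * mom4 (e1 (a - 1) b c) (e2 (a - 1) b c) (e3 (a - 1) b c)
  + 5 * mom6 (e1 (a - 1) b c) (e2 (a - 1) b c) (e3 (a - 1) b c)

lemma step6_eq (a b c : ℤ) : a * step6 a b c =
    coA6 (e1 a b c) (e2 a b c) (e3 a b c) + coB6 (e1 a b c) (e2 a b c) (e3 a b c) * a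
      + coC6 (e1 a b c) (e2 a b c) (e3 a b c) * a ^ 2 := by
  have h := one_letter6 a (e1 a b c) (b * c)
  rw [aux_d, aux_y1, aux_z1, aux_x1, aux_y, aux_z] at h
  simpa only [step6, ← pow_mul, Nat.reduceMul] using h

lemma mom6_rec (a b c : ℤ) : 5 * e1 a b c * mom6 (e1 a b c) (e2 a b c) (e3 a b c) =
    a * step6 a b c + b * step6 b c a + c * step6 c a b := by
  rw [sum_letters6, step6_eq, step6_eq, step6_eq, e1_rot b c a, e2_rot b c a, e3_rot b c a,
    e1_rot a b c, e2_rot a b c, e3_rot a b c, psum2]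
  simp only [e1]
  ring

/-- Coefficient polynomial in the one-letter contribution to the moment of order 8. -/
def coA8 (x y z : ℤ) : ℤ :=
  (((((((-34292160))) * y
    + (((12383280) * x + (-20684160)) * x))) * z
  + (((((7620480) * x + 56173824)) * y
    + (((((-2751840)) * x + (-31679424)) * x + 31401216) * x + (-13716864))) * y
    + (((((5767776) * x + (-9084096)) * x + 921312) * x + 1016064) * x))) * z
  + ((((((((-423360)) * x + (-4886784)) * x + (-26236224))) * y
    + (((((152880) * x + 2834496) * x + 18882192) * x + (-2467584)) * x)) * y
    + (((((((-477792)) * x + (-4898880)) * x + 207648) * x + 6725376) * x + (-5354496)) * x)) * y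
    + ((((((459648) * x + 258048) * x + (-1720320)) * x ^ 2 + 2752512) * x + (-1677312)) * x))) * z

/-- Coefficient polynomial in the one-letter contribution to the moment of order 8. -/
def coB8 (x y z : ℤ) : ℤ :=
  ((((((8037225))) * z
  + (((((-3572100)) * x + (-8573040))) * y
    + (((714420) * x + 13676040) * x + 63134316))) * z
  + ((((((595350) * x + 952560) * x + 7480998)) * y
    + ((((396900) * x + (-489888)) * x + (-60507972)) * x + (-63767088))) * y
    + ((((((-2333268)) * x + 17433360) * x + 12606552) * x + 18842544) * x + (-3490452)))) * z
  + (((((((((-44100)) * x + 105840) * x + (-557676)) * x + (-2349648))) * y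
    + ((((((-114660)) * x + (-659736)) * x + 4274928) * x + 31619448) * x + 19330164)) * y
    + ((((((483112) * x + 132384) * x + (-16949968)) * x + (-12950448)) * x + (-15783768)) * x + 12982032)) * y
    + ((((((((-473200)) * x + 2515968) * x + 1583680) * x + 4085760) * x + 232848) * x + (-7225344)) * x + 4408992))) * z
  + ((((((((((1225) * x + (-11760)) * x + 7238) * x + (-5712)) * x + 945)) * y
    + ((((((6860) * x + 35504) * x + 10024) * x + 24976) * x + 3276) * x)) * y
    + ((((((((-20692)) * x + (-48944)) * x + (-28504)) * x + (-23296)) * x + (-532)) * x + 1008) * x)) * y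
    + ((((((21616) * x + 24192) * x + 11200) * x ^ 2 + 112) * x ^ 2 + (-672)) * x)) * y
    + (((-8064)) * x ^ 8))

/-- Coefficient polynomial in the one-letter contribution to the moment of order 8. -/
def coC8 (x y z : ℤ) : ℤ :=
  ((((((7144200) * x + (-51438240)))) * z
  + ((((((-2381400)) * x + 3333960) * x + 84260736)) * y
    + ((((4445280) * x + (-32604768)) * x + 11730096) * x + (-20575296)))) * z
  + (((((((264600) * x + 317520) * x + (-4156488)) * x + (-39354336))) * y
    + ((((((-705600)) * x + 565488) * x + 21208320) * x + 10181808) * x)) * y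
    + ((((((603232) * x + (-3353280)) * x + (-2331616)) * x + (-430080)) * x + 302400) * x))) * z
  + ((((((((((-9800)) * x + (-5880)) * x + (-13048)) * x + (-3528)) * x)) * y
    + (((((23520) * x + 18032) * x + 30240) * x + 8848) * x ^ 2)) * y
    + ((((((-22624)) * x + (-12096)) * x + (-15904)) * x ^ 2 + 2240) * x ^ 2)) * y
    + ((8064) * x ^ 7))

lemma one_letter8 (a x t : ℤ) :
    a * (945 * ((x - a) ^ 2 - 4 * t) ^ 4
      + 8820 * ((x - a) ^ 2 - 4 * t) ^ 3 * mom2 (x - 1) (a * (x - a) + t - (x - a)) (a * t - t)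
      + 4410 * ((x - a) ^ 2 - 4 * t) ^ 2 * mom4 (x - 1) (a * (x - a) + t - (x - a)) (a * t - t)
      + 420 * ((x - a) ^ 2 - 4 * t) ^ 1 * mom6 (x - 1) (a * (x - a) + t - (x - a)) (a * t - t)
      + 7 * mom8 (x - 1) (a * (x - a) + t - (x - a)) (a * t - t)) =
    coA8 x (a * (x - a) + t) (a * t) + coB8 x (a * (x - a) + t) (a * t) * a
      + coC8 x (a * (x - a) + t) (a * t) * a ^ 2 := by
  simp only [mom2, mom4, mom6, mom8, coA8, coB8, coC8]
  ring

lemma sum_letters8 (x y z : ℤ) :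
    7 * x * mom8 x y z = 3 * coA8 x y z + coB8 x y z * x + coC8 x y z * (x ^ 2 - 2 * y) := by
  simp only [mom8, coA8, coB8, coC8]
  ring

/-- The one-letter contribution to the moment of order 8. -/
def step8 (a b c : ℤ) : ℤ :=
  945 * (b - c) ^ 8
  + 8820 * (b - c) ^ 6 * mom2 (e1 (a - 1) b c) (e2 (a - 1) b c) (e3 (a - 1) b c)
  + 4410 * (b - c) ^ 4 * mom4 (e1 (a - 1) b c) (e2 (a - 1) b c) (e3 (a - 1) b c)
  + 420 * (b - c) ^ 2 * mom6 (e1 (a - 1) b c) (e2 (a - 1) b c) (e3 (a - 1) b c)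
  + 7 * mom8 (e1 (a - 1) b c) (e2 (a - 1) b c) (e3 (a - 1) b c)

lemma step8_eq (a b c : ℤ) : a * step8 a b c =
    coA8 (e1 a b c) (e2 a b c) (e3 a b c) + coB8 (e1 a b c) (e2 a b c) (e3 a b c) * a
      + coC8 (e1 a b c) (e2 a b c) (e3 a b c) * a ^ 2 := by
  have h := one_letter8 a (e1 a b c) (b * c)
  rw [aux_d, aux_y1, aux_z1, aux_x1, aux_y, aux_z] at h
  simpa only [step8, ← pow_mul, Nat.reduceMul] using h

lemma mom8_rec (a b c : ℤ) : 7 * e1 a b c * mom8 (e1 a b c) (e2 a b c) (e3 a b c) =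
    a * step8 a b c + b * step8 b c a + c * step8 c a b := by
  rw [sum_letters8, step8_eq, step8_eq, step8_eq, e1_rot b c a, e2_rot b c a, e3_rot b c a,
    e1_rot a b c, e2_rot a b c, e3_rot a b c, psum2]
  simp only [e1]
  ring

/-- Coefficient polynomial in the one-letter contribution to the moment of order 10. -/
def coA10 (x y z : ℤ) : ℤ :=
  (((((((16974619200)) * y
    + ((((-6129723600)) * x + 13471920000) * x))) * z
  + ((((((-5658206400)) * x + (-51893835840))) * y
    + ((((2043241200) * x + 30271404240) * x + (-45732677760)) * x + 32166046080)) * y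
    + ((((((-5780950560)) * x + 14567636160) * x + (-11341179360)) * x + 9847837440) * x))) * z
  + (((((((628689600) * x + 9520156800) * x + 59330335680)) * y
    + ((((((-227026800)) * x + (-5828850720)) * x + (-44101577520)) * x + 26999360640) * x + (-32009281920))) * y
    + ((((((1042493760) * x + 12502274400) * x + (-14054100480)) * x + 1744938720) * x + 9319484160) * x + (-3879912960))) * y
    + ((((((((-1416898560)) * x + 1768704000) * x + 2057583360) * x + (-2727352320)) * x + 748863360) * x + 886394880) * x))) * z
  + ((((((((((-23284800)) * x + (-417130560)) * x + (-4495296960)) * x + (-23760838080))) * y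
    + ((((((8408400) * x + 255449040) * x + 3476328240) * x + 22251054000) * x + 4107882240) * x)) * y
    + ((((((((-44462880)) * x + (-947173920)) * x + (-7986179040)) * x + (-4135565280)) * x + 10734501120) * x + (-9344240640)) * x)) * y
    + ((((((((93434880) * x + 1283721600) * x + 1569711360) * x + (-4493690880)) * x + (-2367576960)) * x + 13167759360) * x + (-8512358400)) * x)) * y
    + ((((((((((-73382400)) * x + (-201277440)) * x + 361267200) * x + 1393459200) * x + (-2683699200)) * x + (-1114767360)) * x + 4954521600) * x + (-2644992000)) * x))) * z

/-- Coefficient polynomial in the one-letter contribution to the moment of order 10. -/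
def coB10 (x y z : ℤ) : ℤ :=
  ((((((((-2387055825)))) * z
  + ((((1326142125) * x + 5569796925)) * y
    + ((((-1237732650)) * x + (-5557167000)) * x + (-43739956260)))) * z
  + (((((((-294698250)) * x + (-1532430900)) * x + (-7977060630))) * y
    + ((((235758600) * x + 2529352980) * x + 51429054600) * x + 92999419380)) * y
    + (((((1021246380) * x + (-14450879520)) * x + (-19632805920)) * x + (-18781081200)) * x + (-24544307340)))) * z
  + ((((((((32744250) * x + 98232750) * x + 1272909330) * x + 6003424350)) * y
    + (((((13097700) * x + 182245140) * x + (-9108514800)) * x + (-70513968420)) * x + (-75520419660))) * y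
    + (((((((-390976740)) * x + 546236460) * x + 39100032720) * x + 34642543320) * x + 66313587060) * x + (-12458158020))) * y
    + (((((((646125480) * x + (-6138105120)) * x + (-2079781200)) * x + (-17805684960)) * x + (-1930846680)) * x + 6853170240) * x + (-4364902080)))) * z
  + (((((((((((-1819125)) * x + 4365900) * x + (-43305570)) * x + (-405030780)) * x + (-1870019865))) * y
    + (((((((-4851000)) * x + (-66430980)) * x + 242355960) * x + 4996310760) * x + 30459723840) * x + 21422496060)) * y
    + (((((((42850500) * x + 204416520) * x + (-1855908600)) * x + (-22194115440)) * x + (-27404356140)) * x + (-29293601400)) * x + 25895479680)) * y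
    + (((((((((-95190480)) * x + (-19745040)) * x + 5368772640) * x + 8860756800) * x + 15052092720) * x + 2205327600) * x + (-32508362880)) * x + 21626105760)) * y
    + (((((((((74897760) * x + (-472752000)) * x + (-811796160)) * x + (-1699246080)) * x + (-2723303520)) * x + 6429265920) * x + 3384763200) * x + (-13377208320)) * x + 7142567040))) * z
  + ((((((((((((40425) * x + (-444675)) * x + 39270) * x + (-431970)) * x + 945) * x + (-10395))) * y
    + (((((((242550) * x + 2508660) * x + 2323860) * x + 4281480) * x + 2110710) * x + 628740) * x)) * y
    + (((((((((-1335180)) * x + (-6315540)) * x + (-7539000)) * x + (-9754920)) * x + (-3625020)) * x + 23100) * x + 322560) * x)) * y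
    + (((((((((2577960) * x + 7383600) * x + 7672560) * x + 5984160) * x + 64680) * x + (-959280)) * x + (-73920)) * x + (-70560)) * x)) * y
    + ((((((((-2321760)) * x + (-3225600)) * x + (-2130240)) * x ^ 2 + 359520) * x ^ 2 + 181440) * x ^ 2 + (-120960)) * x)) * y
    + ((806400) * x ^ 10))

/-- Coefficient polynomial in the one-letter contribution to the moment of order 10. -/
def coC10 (x y z : ℤ) : ℤ :=
  ((((((((-2652284250)) * x + 25461928800))) * z
  + (((((1178793000) * x + (-2357586000)) * x + (-77840753760))) * y
    + (((((-3064861800)) * x + 31241382480) * x + (-23205382200)) * x + 48249069120))) * z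
  + ((((((((-196465500)) * x + (-471517200)) * x + 8367184980) * x + 88995503520)) * y
    + (((((812057400) * x + (-1410060960)) * x + (-51786808920)) * x + (-2702004480)) * x + (-48013922880))) * y
    + (((((((-1017296280)) * x + 9441321120) * x + (-2533189680)) * x + 12756411360) * x + 7809971400) * x + (-5819869440)))) * z
  + (((((((((14553000) * x + 52390800) * x + (-67442760)) * x + (-4633841520)) * x + (-35641257120))) * y
    + (((((((-66943800)) * x + (-179791920)) * x + 1962243360) * x + 27140687280) * x + 22030830360) * x)) * y
    + (((((((125978160) * x + (-44056320)) * x + (-6552507360)) * x + (-10650430560)) * x + (-4713786000)) * x + 3463780320) * x)) * y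
    + (((((((((-91106400)) * x + 569600640) * x + 1220197440) * x + 1206374400) * x + (-707525280)) * x + (-340623360)) * x + 205571520) * x))) * z
  + ((((((((((((-404250)) * x + (-646800)) * x + (-1446060)) * x + (-1127280)) * x + (-407610)) * x)) * y
    + ((((((1617000) * x + 2808960) * x + 5710320) * x + 4448640) * x + 1543080) * x ^ 2)) * y
    + ((((((((-2818200)) * x + (-4102560)) * x + (-7195440)) * x + (-3696000)) * x + 175560) * x + 702240) * x ^ 2)) * y
    + ((((((2402400) * x + 2016000) * x + 2735040) * x ^ 2 + (-924000)) * x ^ 2 + 221760) * x ^ 2)) * y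
    + (((-806400)) * x ^ 9))

lemma one_letter10 (a x t : ℤ) :
    a * (10395 * ((x - a) ^ 2 - 4 * t) ^ 5
      + 155925 * ((x - a) ^ 2 - 4 * t) ^ 4 * mom2 (x - 1) (a * (x - a) + t - (x - a)) (a * t - t)
      + 145530 * ((x - a) ^ 2 - 4 * t) ^ 3 * mom4 (x - 1) (a * (x - a) + t - (x - a)) (a * t - t)
      + 34650 * ((x - a) ^ 2 - 4 * t) ^ 2 * mom6 (x - 1) (a * (x - a) + t - (x - a)) (a * t - t)
      + 3465 * ((x - a) ^ 2 - 4 * t) ^ 1 * mom8 (x - 1) (a * (x - a) + t - (x - a)) (a * t - t)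
      + 105 * mom10 (x - 1) (a * (x - a) + t - (x - a)) (a * t - t)) =
    coA10 x (a * (x - a) + t) (a * t) + coB10 x (a * (x - a) + t) (a * t) * a
      + coC10 x (a * (x - a) + t) (a * t) * a ^ 2 := by
  simp only [mom2, mom4, mom6, mom8, mom10, coA10, coB10, coC10]
  ring

lemma sum_letters10 (x y z : ℤ) :
    105 * x * mom10 x y z = 3 * coA10 x y z + coB10 x y z * x + coC10 x y z * (x ^ 2 - 2 * y) := by
  simp only [mom10, coA10, coB10, coC10]
  ring

/-- The one-letter contribution to the moment of order 10. -/
def step10 (a b c : ℤ) : ℤ :=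
  10395 * (b - c) ^ 10
  + 155925 * (b - c) ^ 8 * mom2 (e1 (a - 1) b c) (e2 (a - 1) b c) (e3 (a - 1) b c)
  + 145530 * (b - c) ^ 6 * mom4 (e1 (a - 1) b c) (e2 (a - 1) b c) (e3 (a - 1) b c)
  + 34650 * (b - c) ^ 4 * mom6 (e1 (a - 1) b c) (e2 (a - 1) b c) (e3 (a - 1) b c)
  + 3465 * (b - c) ^ 2 * mom8 (e1 (a - 1) b c) (e2 (a - 1) b c) (e3 (a - 1) b c)
  + 105 * mom10 (e1 (a - 1) b c) (e2 (a - 1) b c) (e3 (a - 1) b c)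

lemma step10_eq (a b c : ℤ) : a * step10 a b c =
    coA10 (e1 a b c) (e2 a b c) (e3 a b c) + coB10 (e1 a b c) (e2 a b c) (e3 a b c) * a
      + coC10 (e1 a b c) (e2 a b c) (e3 a b c) * a ^ 2 := by
  have h := one_letter10 a (e1 a b c) (b * c)
  rw [aux_d, aux_y1, aux_z1, aux_x1, aux_y, aux_z] at h
  simpa only [step10, ← pow_mul, Nat.reduceMul] using h

lemma mom10_rec (a b c : ℤ) : 105 * e1 a b c * mom10 (e1 a b c) (e2 a b c) (e3 a b c) =
    a * step10 a b c + b * step10 b c a + c * step10 c a b := by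
  rw [sum_letters10, step10_eq, step10_eq, step10_eq, e1_rot b c a, e2_rot b c a, e3_rot b c a,
    e1_rot a b c, e2_rot a b c, e3_rot a b c, psum2]
  simp only [e1]
  ring

/-- Words over the alphabet `{1,2,3}`. -/
def Letters (w : List ℕ) : Prop := ∀ x ∈ w, x = 1 ∨ x = 2 ∨ x = 3

/-- Signed number of pairs `(x before y)` minus `(y before x)`. -/
def bal (x y : ℕ) : List ℕ → ℤ
  | [] => 0
  | z :: w => bal x y w + (if z = x then (w.count y : ℤ) else 0) - (if z = y then (w.count x : ℤ) else 0)

/-- The algebraic-area statistic. -/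
def area (w : List ℕ) : ℤ := bal 1 2 w + bal 2 3 w + bal 3 1 w

/-- The odd patterns. -/
abbrev OddPat (x y z : ℕ) : Prop := (x < z ∧ z < y) ∨ (y < x ∧ x < z) ∨ (z < y ∧ y < x)

/-- Number of later letters completing an odd pattern started by `x y`. -/
def single (x y : ℕ) (w : List ℕ) : ℕ :=
  ∑ k : Fin w.length, if OddPat x y (w.get k) then 1 else 0

/-- Number of pairs of letters completing an odd pattern started by `x`. -/
def pairs (x : ℕ) (w : List ℕ) : ℕ :=
  ∑ j : Fin w.length, ∑ k : Fin w.length, if j < k ∧ OddPat x (w.get j) (w.get k) then 1 else 0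

lemma single_cons (x y z : ℕ) (w : List ℕ) :
    single x y (z :: w) = (if OddPat x y z then 1 else 0) + single x y w := by
  unfold single
  exact Fin.sum_univ_succ (n := w.length) _

lemma pairs_cons (x y : ℕ) (w : List ℕ) :
    pairs x (y :: w) = single x y w + pairs x w := by
  unfold pairs single
  refine (Fin.sum_univ_succ (n := w.length) _).trans ?_
  congr 1
  · refine (Fin.sum_univ_succ (n := w.length) _).trans ?_
    simp
  · refine Finset.sum_congr rfl fun j _ => ?_
    refine (Fin.sum_univ_succ (n := w.length) _).trans ?_
    simp

lemma gep_eq_sum (w : List ℕ) : gep w =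
    ∑ i : Fin w.length, ∑ j : Fin w.length, ∑ k : Fin w.length,
      if i < j ∧ j < k ∧ OddPat (w.get i) (w.get j) (w.get k) then 1 else 0 := by
  unfold gep
  rw [Finset.card_filter, Fintype.sum_prod_type]
  refine Finset.sum_congr rfl fun i _ => ?_
  rw [Fintype.sum_prod_type]

lemma gep_cons (x : ℕ) (w : List ℕ) : gep (x :: w) = pairs x w + gep w := by
  rw [gep_eq_sum, gep_eq_sum]
  unfold pairs
  refine (Fin.sum_univ_succ (n := w.length) _).trans ?_
  congr 1
  · refine (Fin.sum_univ_succ (n := w.length) _).trans ?_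
    simp only [lt_irrefl, false_and, if_false, Finset.sum_const_zero, zero_add]
    refine Finset.sum_congr rfl fun j _ => ?_
    refine (Fin.sum_univ_succ (n := w.length) _).trans ?_
    simp
  · refine Finset.sum_congr rfl fun i _ => ?_
    refine (Fin.sum_univ_succ (n := w.length) _).trans ?_
    simp only [Fin.not_lt_zero, false_and, if_false, Finset.sum_const_zero, zero_add]
    refine Finset.sum_congr rfl fun j _ => ?_
    refine (Fin.sum_univ_succ (n := w.length) _).trans ?_
    simp

lemma Letters.tail {x : ℕ} {w : List ℕ} (h : Letters (x :: w)) : Letters w :=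
  fun y hy => h y (List.mem_cons_of_mem _ hy)

lemma Letters.head {x : ℕ} {w : List ℕ} (h : Letters (x :: w)) : x = 1 ∨ x = 2 ∨ x = 3 :=
  h x List.mem_cons_self

lemma single_eq (w : List ℕ) (h : Letters w) :
    single 1 1 w = 0 ∧ single 1 2 w = 0 ∧ single 1 3 w = w.count 2 ∧
    single 2 1 w = w.count 3 ∧ single 2 2 w = 0 ∧ single 2 3 w = 0 ∧
    single 3 1 w = 0 ∧ single 3 2 w = w.count 1 ∧ single 3 3 w = 0 := by
  induction w with
  | nil => simp [single]
  | cons z w ih =>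
    obtain ⟨h1, h2, h3, h4, h5, h6, h7, h8, h9⟩ := ih h.tail
    simp only [single_cons, h1, h2, h3, h4, h5, h6, h7, h8, h9]
    rcases h.head with rfl | rfl | rfl <;> simp [add_comm, OddPat]

lemma pairs_eq (w : List ℕ) (h : Letters w) :
    2 * (pairs 1 w : ℤ) = w.count 2 * w.count 3 - bal 2 3 w ∧
    2 * (pairs 2 w : ℤ) = w.count 3 * w.count 1 - bal 3 1 w ∧
    2 * (pairs 3 w : ℤ) = w.count 1 * w.count 2 - bal 1 2 w := by
  induction w with
  | nil => simp [pairs, bal]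
  | cons z w ih =>
    obtain ⟨h1, h2, h3⟩ := ih h.tail
    obtain ⟨s1, s2, s3, s4, s5, s6, s7, s8, s9⟩ := single_eq w h.tail
    rcases h.head with rfl | rfl | rfl <;>
    · simp [pairs_cons, bal, s1, s2, s3, s4, s5, s6, s7, s8, s9, mul_add, h1, h2, h3]
      try ring_nf
      try simp

lemma gep_eq (w : List ℕ) (h : Letters w) :
    2 * (gep w : ℤ) = w.count 1 * w.count 2 * w.count 3
      - (w.count 3 * bal 1 2 w + w.count 1 * bal 2 3 w + w.count 2 * bal 3 1 w) := by
  induction w with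
  | nil => simp [gep, bal]
  | cons z w ih =>
    obtain ⟨h1, h2, h3⟩ := pairs_eq w h.tail
    have ih := ih h.tail
    rcases h.head with rfl | rfl | rfl <;>
    · simp [gep_cons, bal, mul_add, h1, h2, h3, ih]
      ring

lemma mem_W (a b c : ℕ) (w : List ℕ) :
    w ∈ W a b c ↔ Letters w ∧ w.count 1 = a ∧ w.count 2 = b ∧ w.count 3 = c := by
  unfold W
  rw [List.mem_toFinset, List.mem_permutations]
  constructor
  · intro h
    refine ⟨fun x hx => ?_, ?_, ?_, ?_⟩
    · have := h.mem_iff.1 hx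
      simp [List.mem_replicate] at this
      tauto
    all_goals
      rw [h.count_eq]
      simp [List.count_replicate]
  · rintro ⟨hl, rfl, rfl, rfl⟩
    rw [List.perm_iff_count]
    intro x
    by_cases hx : x ∈ w
    · rcases hl x hx with rfl | rfl | rfl <;> simp [List.count_replicate]
    · have h0 : w.count x = 0 := List.count_eq_zero.2 hx
      simp only [List.count_append, List.count_replicate, beq_iff_eq, h0]
      split_ifs with h1 h2 h3 <;> subst_vars <;> simp_all

lemma bal_append (x y z : ℕ) (w : List ℕ) :
    bal x y (w ++ [z]) = bal x y w - (if z = x then (w.count y : ℤ) else 0)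
      + (if z = y then (w.count x : ℤ) else 0) := by
  induction w with
  | nil => simp [bal]
  | cons t w ih =>
    simp only [List.cons_append, bal, ih, List.count_append, List.count_cons, List.count_nil,
      beq_iff_eq]
    push_cast
    split_ifs <;> simp <;> try ring

lemma bal_reverse (x y : ℕ) (w : List ℕ) : bal x y w.reverse = - bal x y w := by
  induction w with
  | nil => simp [bal]
  | cons t w ih =>
    rw [List.reverse_cons, bal_append, ih, List.count_reverse, List.count_reverse]
    simp only [bal]
    ring

lemma area_reverse (w : List ℕ) : area w.reverse = - area w := by
  simp only [area, bal_reverse]; ring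

lemma odd_sum (a b c r : ℕ) (hr : Odd r) : ∑ w ∈ W a b c, area w ^ r = 0 := by
  have h : ∑ w ∈ W a b c, area w ^ r = ∑ w ∈ W a b c, - area w ^ r := by
    refine Finset.sum_nbij' List.reverse List.reverse ?_ ?_ ?_ ?_ ?_
    · intro w hw
      rw [mem_W] at hw ⊢
      simpa [Letters] using hw
    · intro w hw
      rw [mem_W] at hw ⊢
      simpa [Letters] using hw
    · simp
    · simp
    · intro w _
      rw [area_reverse, hr.neg_pow, neg_neg]
  rw [Finset.sum_neg_distrib] at h
  linarith

/-- Multinomial coefficient. -/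
def mult (a b c : ℕ) : ℚ := ((a + b + c).factorial : ℚ) / (a.factorial * b.factorial * c.factorial)

lemma sum_W (a b c : ℕ) (h : 0 < a + b + c) (f : List ℕ → ℤ) :
    ∑ w ∈ W a b c, f w =
      ∑ w ∈ (if a = 0 then ∅ else W (a - 1) b c), f (1 :: w)
      + ∑ w ∈ (if b = 0 then ∅ else W a (b - 1) c), f (2 :: w)
      + ∑ w ∈ (if c = 0 then ∅ else W a b (c - 1)), f (3 :: w) := by
  have inj : ∀ x : ℕ, Function.Injective (List.cons x) := fun x => List.cons_injective
  have hW : W a b c =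
      (((if a = 0 then ∅ else W (a - 1) b c).map ⟨List.cons 1, inj 1⟩)
      ∪ ((if b = 0 then ∅ else W a (b - 1) c).map ⟨List.cons 2, inj 2⟩))
      ∪ ((if c = 0 then ∅ else W a b (c - 1)).map ⟨List.cons 3, inj 3⟩) := by
    ext w
    simp only [Finset.mem_union, Finset.mem_map, Function.Embedding.coeFn_mk]
    have key : ∀ (p : Prop) [Decidable p] (S : Finset (List ℕ)) (v : List ℕ),
        v ∈ (if p then ∅ else S) ↔ ¬ p ∧ v ∈ S := by
      intro p _ S v
      split_ifs <;> simp [*]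
    simp only [key, mem_W]
    cases w with
    | nil => simp; omega
    | cons z w =>
      constructor
      · rintro ⟨hl, h1, h2, h3⟩
        have ht := hl.tail
        rcases hl.head with rfl | rfl | rfl
        · left; left
          simp at h1 h2 h3
          exact ⟨w, ⟨by omega, ht, by omega, by omega, by omega⟩, rfl⟩
        · left; right
          simp at h1 h2 h3
          exact ⟨w, ⟨by omega, ht, by omega, by omega, by omega⟩, rfl⟩
        · right
          simp at h1 h2 h3
          exact ⟨w, ⟨by omega, ht, by omega, by omega, by omega⟩, rfl⟩
      · rintro ((⟨v, ⟨h0, hl, h1, h2, h3⟩, he⟩ | ⟨v, ⟨h0, hl, h1, h2, h3⟩, he⟩) |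
          ⟨v, ⟨h0, hl, h1, h2, h3⟩, he⟩) <;>
        · obtain ⟨rfl, rfl⟩ := List.cons.inj he
          refine ⟨?_, ?_, ?_, ?_⟩
          · intro x hx
            rcases List.mem_cons.1 hx with rfl | hx
            · simp
            · exact hl x hx
          all_goals
            simp
            omega
  rw [hW, Finset.sum_union, Finset.sum_union]
  · simp only [Finset.sum_map, Function.Embedding.coeFn_mk]
  · rw [Finset.disjoint_left]
    intro w h1 h2
    simp only [Finset.mem_map, Function.Embedding.coeFn_mk] at h1 h2
    obtain ⟨v, _, rfl⟩ := h1
    obtain ⟨u, _, hu⟩ := h2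
    simp at hu
  · rw [Finset.disjoint_left]
    intro w h1 h2
    simp only [Finset.mem_union, Finset.mem_map, Function.Embedding.coeFn_mk] at h1 h2
    obtain ⟨u, _, rfl⟩ := h2
    rcases h1 with ⟨v, _, hv⟩ | ⟨v, _, hv⟩ <;> simp at hv

/-- The moments of `area` over `S` up to order ten are those predicted for weight `K`. -/
structure Good (S : Finset (List ℕ)) (K : ℚ) (a b c : ℤ) : Prop where
  hodd : ∀ r, Odd r → ∑ w ∈ S, area w ^ r = 0
  h0 : ((∑ w ∈ S, area w ^ 0 : ℤ) : ℚ) = K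
  h2 : 3 * ((∑ w ∈ S, area w ^ 2 : ℤ) : ℚ) = K * mom2 (e1 a b c) (e2 a b c) (e3 a b c)
  h4 : 15 * ((∑ w ∈ S, area w ^ 4 : ℤ) : ℚ) = K * mom4 (e1 a b c) (e2 a b c) (e3 a b c)
  h6 : 63 * ((∑ w ∈ S, area w ^ 6 : ℤ) : ℚ) = K * mom6 (e1 a b c) (e2 a b c) (e3 a b c)
  h8 : 135 * ((∑ w ∈ S, area w ^ 8 : ℤ) : ℚ) = K * mom8 (e1 a b c) (e2 a b c) (e3 a b c)
  h10 : 99 * ((∑ w ∈ S, area w ^ 10 : ℤ) : ℚ) = K * mom10 (e1 a b c) (e2 a b c) (e3 a b c)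

lemma Good.rot {S : Finset (List ℕ)} {K : ℚ} {a b c : ℤ} (h : Good S K a b c) :
    Good S K b c a := by
  obtain ⟨hodd, h0, h2, h4, h6, h8, h10⟩ := h
  constructor <;> (try simp only [e1_rot a b c, e2_rot a b c, e3_rot a b c]) <;> assumption

lemma shift_pow (S : Finset (List ℕ)) (d : ℤ) (r : ℕ) : ∑ w ∈ S, (area w + d) ^ r =
    ∑ j ∈ Finset.range (r + 1), (∑ w ∈ S, area w ^ j) * d ^ (r - j) * (r.choose j) := by
  simp only [add_pow, Finset.sum_mul]
  exact Finset.sum_comm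

/-- Moments after prepending a letter. -/
structure Shifted (S : Finset (List ℕ)) (K : ℚ) (a b c : ℤ) : Prop where
  s0 : ((∑ w ∈ S, (area w + (b - c)) ^ 0 : ℤ) : ℚ) = K
  s2 : 3 * ((∑ w ∈ S, (area w + (b - c)) ^ 2 : ℤ) : ℚ) = K * step2 a b c
  s4 : 15 * ((∑ w ∈ S, (area w + (b - c)) ^ 4 : ℤ) : ℚ) = K * step4 a b c
  s6 : 315 * ((∑ w ∈ S, (area w + (b - c)) ^ 6 : ℤ) : ℚ) = K * step6 a b c
  s8 : 945 * ((∑ w ∈ S, (area w + (b - c)) ^ 8 : ℤ) : ℚ) = K * step8 a b c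
  s10 : 10395 * ((∑ w ∈ S, (area w + (b - c)) ^ 10 : ℤ) : ℚ) = K * step10 a b c

lemma Good.shifted {S : Finset (List ℕ)} {K : ℚ} {a b c : ℤ} (h : Good S K (a - 1) b c) :
    Shifted S K a b c := by
  obtain ⟨hodd, h0, h2, h4, h6, h8, h10⟩ := h
  have o1 := hodd 1 (by decide)
  have o3 := hodd 3 (by decide)
  have o5 := hodd 5 (by decide)
  have o7 := hodd 7 (by decide)
  have o9 := hodd 9 (by decide)
  constructor
  · simpa using h0
  · rw [shift_pow]
    simp only [Finset.sum_range_succ, Finset.sum_range_zero, o1]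
    simp only [step2]
    norm_num [Nat.choose] at h0 h2 ⊢
    generalize ((b : ℚ) - c) = d at *
    linear_combination h2 + 3 * d ^ 2 * h0
  · rw [shift_pow]
    simp only [Finset.sum_range_succ, Finset.sum_range_zero, o1, o3]
    simp only [step4]
    norm_num [Nat.choose] at h0 h2 h4 ⊢
    generalize ((b : ℚ) - c) = d at *
    linear_combination h4 + 30 * d ^ 2 * h2 + 15 * d ^ 4 * h0
  · rw [shift_pow]
    simp only [Finset.sum_range_succ, Finset.sum_range_zero, o1, o3, o5]
    simp only [step6]
    norm_num [Nat.choose] at h0 h2 h4 h6 ⊢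
    generalize ((b : ℚ) - c) = d at *
    linear_combination 5 * h6 + 315 * d ^ 2 * h4 + 1575 * d ^ 4 * h2 + 315 * d ^ 6 * h0
  · rw [shift_pow]
    simp only [Finset.sum_range_succ, Finset.sum_range_zero, o1, o3, o5, o7]
    simp only [step8]
    norm_num [Nat.choose] at h0 h2 h4 h6 h8 ⊢
    generalize ((b : ℚ) - c) = d at *
    linear_combination 7 * h8 + 420 * d ^ 2 * h6 + 4410 * d ^ 4 * h4 + 8820 * d ^ 6 * h2 + 945 * d ^ 8 * h0
  · rw [shift_pow]
    simp only [Finset.sum_range_succ, Finset.sum_range_zero, o1, o3, o5, o7, o9]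
    simp only [step10]
    norm_num [Nat.choose] at h0 h2 h4 h6 h8 h10 ⊢
    generalize ((b : ℚ) - c) = d at *
    linear_combination 105 * h10 + 3465 * d ^ 2 * h8 + 34650 * d ^ 4 * h6 + 145530 * d ^ 6 * h4
      + 155925 * d ^ 8 * h2 + 10395 * d ^ 10 * h0

lemma good_empty (a b c : ℤ) : Good ∅ 0 a b c := by
  constructor <;> simp

lemma area_cons (w : List ℕ) : area (1 :: w) = area w + ((w.count 2 : ℤ) - w.count 3) ∧
    area (2 :: w) = area w + ((w.count 3 : ℤ) - w.count 1) ∧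
    area (3 :: w) = area w + ((w.count 1 : ℤ) - w.count 2) := by
  refine ⟨?_, ?_, ?_⟩ <;> simp [area, bal] <;> ring

lemma mult_succ1 (a b c : ℕ) :
    mult a b c = ((a + 1 : ℕ) : ℚ) / ((a + 1 + b + c : ℕ) : ℚ) * mult (a + 1) b c := by
  unfold mult
  have e : a + 1 + b + c = (a + b + c) + 1 := by ring
  rw [e, Nat.factorial_succ, Nat.factorial_succ]
  have := Nat.factorial_pos a
  have := Nat.factorial_pos b
  have := Nat.factorial_pos c
  push_cast
  field_simp

lemma mult_rot (a b c : ℕ) : mult b c a = mult a b c := by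
  unfold mult
  rw [show b + c + a = a + b + c by ring]
  congr 1
  ring

lemma combine (N x y z S1 S2 S3 K m L L' : ℚ) (s1 s2 s3 : ℚ) (hN : N ≠ 0) (hL : L ≠ 0)
    (h1 : L * L' * S1 = x / N * K * s1) (h2 : L * L' * S2 = y / N * K * s2)
    (h3 : L * L' * S3 = z / N * K * s3) (hm : L * N * m = x * s1 + y * s2 + z * s3) :
    L' * (S1 + S2 + S3) = K * m := by
  have : L * N * (L' * (S1 + S2 + S3)) = L * N * (K * m) := by
    have e1 : N * (L * L' * S1) = x * K * s1 := by rw [h1]; field_simp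
    have e2 : N * (L * L' * S2) = y * K * s2 := by rw [h2]; field_simp
    have e3 : N * (L * L' * S3) = z * K * s3 := by rw [h3]; field_simp
    linear_combination e1 + e2 + e3 - K * hm
  exact mul_left_cancel₀ (mul_ne_zero hL hN) this

lemma good_W (N : ℕ) : ∀ a b c : ℕ, a + b + c = N → Good (W a b c) (mult a b c) a b c := by
  induction N with
  | zero =>
    intro a b c h
    obtain ⟨rfl, rfl, rfl⟩ : a = 0 ∧ b = 0 ∧ c = 0 := by omega
    have hW : W 0 0 0 = {[]} := by simp [W]
    rw [hW]
    constructor <;>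
      simp [area, bal, mult, e1, e2, e3, mom2, mom4, mom6, mom8, mom10]
    intro r hr h0
    subst h0
    simp at hr
  | succ N ih =>
    intro a b c h
    have hNq : (((a + b + c : ℕ)) : ℚ) ≠ 0 := by rw [h]; positivity
    have hpos : 0 < a + b + c := by omega
    have g1 : Shifted (if a = 0 then ∅ else W (a - 1) b c)
        ((a : ℚ) / ((a + b + c : ℕ) : ℚ) * mult a b c) a b c := by
      apply Good.shifted
      rcases a with _ | a
      · simpa using good_empty _ _ _
      · have := ih a b c (by omega)
        rw [mult_succ1] at this
        simpa using this
    have g2 : Shifted (if b = 0 then ∅ else W a (b - 1) c)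
        ((b : ℚ) / ((a + b + c : ℕ) : ℚ) * mult a b c) b c a := by
      apply Good.shifted
      rcases b with _ | b
      · simpa using good_empty _ _ _
      · have := (ih a b c (by omega)).rot
        rw [← mult_rot, mult_succ1, mult_rot a (b + 1) c,
          show b + 1 + c + a = a + (b + 1) + c by ring] at this
        simpa using this
    have g3 : Shifted (if c = 0 then ∅ else W a b (c - 1))
        ((c : ℚ) / ((a + b + c : ℕ) : ℚ) * mult a b c) c a b := by
      apply Good.shifted
      rcases c with _ | c
      · simpa using good_empty _ _ _
      · have := (ih a b c (by omega)).rot.rot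
        rw [← mult_rot, ← mult_rot, mult_succ1, mult_rot b (c + 1) a, mult_rot a b (c + 1),
          show c + 1 + a + b = a + b + (c + 1) by ring] at this
        simpa using this
    have hsum : ∀ r : ℕ, ∑ w ∈ W a b c, area w ^ r =
        ∑ w ∈ (if a = 0 then ∅ else W (a - 1) b c), (area w + ((b : ℤ) - c)) ^ r
        + ∑ w ∈ (if b = 0 then ∅ else W a (b - 1) c), (area w + ((c : ℤ) - a)) ^ r
        + ∑ w ∈ (if c = 0 then ∅ else W a b (c - 1)), (area w + ((a : ℤ) - b)) ^ r := by
      intro r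
      rw [sum_W a b c hpos]
      congr 1
      · congr 1
        · refine Finset.sum_congr rfl fun w hw => ?_
          split_ifs at hw with h0
          · simp at hw
          · rw [mem_W] at hw
            rw [(area_cons w).1, hw.2.2.1, hw.2.2.2]
        · refine Finset.sum_congr rfl fun w hw => ?_
          split_ifs at hw with h0
          · simp at hw
          · rw [mem_W] at hw
            rw [(area_cons w).2.1, hw.2.1, hw.2.2.2]
      · refine Finset.sum_congr rfl fun w hw => ?_
        split_ifs at hw with h0
        · simp at hw
        · rw [mem_W] at hw
          rw [(area_cons w).2.2, hw.2.1, hw.2.2.1]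
    have hN' : (((a + b + c : ℕ)) : ℚ) = (e1 a b c : ℚ) := by simp [e1]
    rw [hN'] at g1 g2 g3 hNq
    refine ⟨fun r hr => odd_sum a b c r hr, ?_, ?_, ?_, ?_, ?_, ?_⟩
    · rw [hsum, Int.cast_add, Int.cast_add, g1.s0, g2.s0, g3.s0, ← add_mul, ← add_mul, ← add_div,
        ← add_div]
      have : (a : ℚ) + b + c = (e1 a b c : ℚ) := by simp [e1]
      rw [this, div_self hNq, one_mul]
    · rw [hsum, Int.cast_add, Int.cast_add]
      exact combine _ a b c _ _ _ _ _ 1 3 _ _ _ hNq (by norm_num)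
        (by norm_num only; exact g1.s2) (by norm_num only; exact g2.s2)
        (by norm_num only; exact g3.s2) (by exact_mod_cast mom2_rec a b c)
    · rw [hsum, Int.cast_add, Int.cast_add]
      exact combine _ a b c _ _ _ _ _ 1 15 _ _ _ hNq (by norm_num)
        (by norm_num only; exact g1.s4) (by norm_num only; exact g2.s4)
        (by norm_num only; exact g3.s4) (by exact_mod_cast mom4_rec a b c)
    · rw [hsum, Int.cast_add, Int.cast_add]
      exact combine _ a b c _ _ _ _ _ 5 63 _ _ _ hNq (by norm_num)
        (by norm_num only; exact g1.s6) (by norm_num only; exact g2.s6)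
        (by norm_num only; exact g3.s6) (by exact_mod_cast mom6_rec a b c)
    · rw [hsum, Int.cast_add, Int.cast_add]
      exact combine _ a b c _ _ _ _ _ 7 135 _ _ _ hNq (by norm_num)
        (by norm_num only; exact g1.s8) (by norm_num only; exact g2.s8)
        (by norm_num only; exact g3.s8) (by exact_mod_cast mom8_rec a b c)
    · rw [hsum, Int.cast_add, Int.cast_add]
      exact combine _ a b c _ _ _ _ _ 105 99 _ _ _ hNq (by norm_num)
        (by norm_num only; exact g1.s10) (by norm_num only; exact g2.s10)
        (by norm_num only; exact g3.s10) (by exact_mod_cast mom10_rec a b c)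

lemma gep_central (n : ℕ) (w : List ℕ) (hw : w ∈ W n n n) :
    (gep w : ℚ) - (n : ℚ) ^ 3 / 2 = -(n / 2) * (area w : ℚ) := by
  rw [mem_W] at hw
  obtain ⟨hl, h1, h2, h3⟩ := hw
  have h := gep_eq w hl
  rw [h1, h2, h3] at h
  have hq : 2 * (gep w : ℚ) = n * n * n - (n * bal 1 2 w + n * bal 2 3 w + n * bal 3 1 w) := by
    exact_mod_cast h
  simp only [area]
  push_cast
  linear_combination hq / 2

theorem gep_words_tenth_central_moment (n : ℕ) (hn : 1 ≤ n) :
    (∑ w ∈ W n n n, ((gep w : ℚ) - (n : ℚ) ^ 3 / 2) ^ 10) / ((W n n n).card : ℚ) =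
      (n : ℚ) ^ 13 * (3 * (n : ℚ) - 4)
        * (68985 * (n : ℚ) ^ 6 - 469716 * (n : ℚ) ^ 5 + 1391760 * (n : ℚ) ^ 4
            - 2251584 * (n : ℚ) ^ 3 + 2072832 * (n : ℚ) ^ 2 - 1022208 * (n : ℚ) + 209920)
        / 11264 := by
  have hg := good_W _ n n n rfl
  have h0 : ((W n n n).card : ℚ) = mult n n n := by
    have := hg.h0
    simpa using this
  have hK : mult n n n ≠ 0 := by
    unfold mult
    positivity
  have hs : ∑ w ∈ W n n n, ((gep w : ℚ) - (n : ℚ) ^ 3 / 2) ^ 10 =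
      (n : ℚ) ^ 10 / 1024 * ((∑ w ∈ W n n n, area w ^ 10 : ℤ) : ℚ) := by
    rw [Int.cast_sum, Finset.mul_sum]
    refine Finset.sum_congr rfl fun w hw => ?_
    rw [gep_central n w hw]
    push_cast
    ring
  have h10 : ((∑ w ∈ W n n n, area w ^ 10 : ℤ) : ℚ) =
      mult n n n * (mom10 (e1 n n n) (e2 n n n) (e3 n n n) : ℚ) / 99 := by
    rw [← hg.h10]; ring
  rw [hs, h10, h0]
  have : (n : ℚ) ^ 10 / 1024 * (mult n n n * (mom10 (e1 n n n) (e2 n n n) (e3 n n n) : ℚ) / 99)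
      / mult n n n = (n : ℚ) ^ 10 / 1024 * (mom10 (e1 n n n) (e2 n n n) (e3 n n n) : ℚ) / 99 := by
    field_simp
  rw [this]
  simp only [mom10, e1, e2, e3]
  push_cast
  ring
end

section
/- For every n ≥ 1, the twelfth central moment of the Gepner statistic over W(n,n,n) equals n¹⁵·((343717911/1863680)n⁹ − (265635477/116480)n⁸ + (93771627/7280)n⁷ − (45012561/1040)n⁶ + (43093563/455)n⁵ − (77940021/560)n⁴ + (62196357/455)n³ − (39213532/455)n² + (14354176/455)n − 463661/91); that is, (1/|W(n,n,n)|) Σ_{w ∈ W(n,n,n)} (gep(w) − n³/2)¹² equals this polynomial expression (as an identity in ℚ). -/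
/-! ### Reflection: polynomials in `e1, e2, e3` as nested lists -/

namespace GepAux

/-- Coefficientwise addition of dense lists. -/
def ladd {α : Type} (f : α → α → α) : List α → List α → List α
  | [], l => l
  | x :: xs, [] => x :: xs
  | x :: xs, y :: ys => f x y :: ladd f xs ys

/-- Horner evaluation. -/
def lev {α : Type} (ev : α → ℚ) (x : ℚ) : List α → ℚ
  | [] => 0
  | c :: cs => ev c + x * lev ev x cs

theorem lev_ladd {α : Type} (f : α → α → α) (ev : α → ℚ) (x : ℚ)
    (h : ∀ a b, ev (f a b) = ev a + ev b) :
    ∀ l m, lev ev x (ladd f l m) = lev ev x l + lev ev x m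
  | [], l => by simp [ladd, lev]
  | x :: xs, [] => by simp [ladd, lev]
  | a :: xs, b :: ys => by
      simp only [ladd, lev, h, lev_ladd f ev x h xs ys]; ring

theorem lev_map {α : Type} (g : α → α) (ev : α → ℚ) (x c : ℚ)
    (h : ∀ a, ev (g a) = c * ev a) :
    ∀ l, lev ev x (l.map g) = c * lev ev x l
  | [] => by simp [lev]
  | a :: xs => by
      simp only [List.map, lev, h, lev_map g ev x c h xs]; ring

theorem lev_zero {α : Type} (z : α → Bool) (ev : α → ℚ) (x : ℚ)
    (h : ∀ a, z a = true → ev a = 0) :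
    ∀ l : List α, l.all z = true → lev ev x l = 0
  | [], _ => by simp [lev]
  | a :: xs, hl => by
      simp only [List.all_cons, Bool.and_eq_true] at hl
      simp [lev, h a hl.1, lev_zero z ev x h xs hl.2]

abbrev Q1 := List Int
abbrev Q2 := List Q1
abbrev Q3 := List Q2

def ev1 (e1 : ℚ) : Q1 → ℚ := lev (fun c : Int => (c : ℚ)) e1
def ev2 (e1 e2 : ℚ) : Q2 → ℚ := lev (ev1 e1) e2
def ev3 (e1 e2 e3 : ℚ) : Q3 → ℚ := lev (ev2 e1 e2) e3

def add1 : Q1 → Q1 → Q1 := ladd Int.add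
def add2 : Q2 → Q2 → Q2 := ladd add1
def add3 : Q3 → Q3 → Q3 := ladd add2
def sc1 (k : Int) : Q1 → Q1 := List.map (Int.mul k)
def sc2 (k : Int) : Q2 → Q2 := List.map (sc1 k)
def sc3 (k : Int) : Q3 → Q3 := List.map (sc2 k)
def x1 : Q3 → Q3 := List.map (List.map (List.cons 0))
def x2 : Q3 → Q3 := List.map (List.cons [])
def x3 : Q3 → Q3 := List.cons []

def isZ : Q3 → Bool := fun l => l.all (fun l => l.all (fun l => l.all (fun c => decide (c = 0))))

variable (e1 e2 e3 : ℚ)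

theorem ev3_add (p q : Q3) : ev3 e1 e2 e3 (add3 p q) = ev3 e1 e2 e3 p + ev3 e1 e2 e3 q :=
  lev_ladd _ _ _ (lev_ladd _ _ _ (lev_ladd _ _ _ (fun a b => Int.cast_add a b))) p q

theorem ev3_sc (k : Int) (p : Q3) : ev3 e1 e2 e3 (sc3 k p) = (k : ℚ) * ev3 e1 e2 e3 p :=
  lev_map _ _ _ _ (lev_map _ _ _ _ (lev_map _ _ _ _ (fun a => Int.cast_mul k a))) p

theorem ev3_x1 (p : Q3) : ev3 e1 e2 e3 (x1 p) = e1 * ev3 e1 e2 e3 p :=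
  lev_map _ _ _ _ (lev_map _ _ _ _ (fun a => by simp [ev1, lev])) p

theorem ev3_x2 (p : Q3) : ev3 e1 e2 e3 (x2 p) = e2 * ev3 e1 e2 e3 p :=
  lev_map _ _ _ _ (fun a => by simp [ev2, ev1, lev]) p

theorem ev3_x3 (p : Q3) : ev3 e1 e2 e3 (x3 p) = e3 * ev3 e1 e2 e3 p := by
  simp [ev3, ev2, x3, lev]

theorem ev3_isZ (p : Q3) (h : isZ p = true) : ev3 e1 e2 e3 p = 0 :=
  lev_zero _ _ _ (lev_zero _ _ _ (lev_zero _ _ _ (fun c hc => by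
    have : c = 0 := by simpa using hc
    simp [this]))) p h

/-- Elements `q0 + q1 a + q2 a^2` of the cubic algebra. -/
structure T where
  q0 : Q3
  q1 : Q3
  q2 : Q3

def evT (a : ℚ) (t : T) : ℚ :=
  ev3 e1 e2 e3 t.q0 + ev3 e1 e2 e3 t.q1 * a + ev3 e1 e2 e3 t.q2 * a ^ 2

def T.add (s t : T) : T := ⟨add3 s.q0 t.q0, add3 s.q1 t.q1, add3 s.q2 t.q2⟩
def T.sc (k : Int) (t : T) : T := ⟨sc3 k t.q0, sc3 k t.q1, sc3 k t.q2⟩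
def T.x1 (t : T) : T := ⟨GepAux.x1 t.q0, GepAux.x1 t.q1, GepAux.x1 t.q2⟩
def T.x2 (t : T) : T := ⟨GepAux.x2 t.q0, GepAux.x2 t.q1, GepAux.x2 t.q2⟩
def T.x3 (t : T) : T := ⟨GepAux.x3 t.q0, GepAux.x3 t.q1, GepAux.x3 t.q2⟩
def T.xa (t : T) : T :=
  ⟨GepAux.x3 t.q2, add3 t.q0 (sc3 (-1) (GepAux.x2 t.q2)), add3 t.q1 (GepAux.x1 t.q2)⟩

def T.m1 (t : T) : T := t.x1.add (t.sc (-1))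
def T.m2 (t : T) : T := (t.x2.add (t.x1.sc (-1))).add t.xa
def T.m3 (t : T) : T := (t.x3.add (t.x2.sc (-1))).add (t.xa.x1.add (t.xa.xa.sc (-1)))
def T.mD (t : T) : T :=
  (t.x1.x1.add (t.x2.sc (-4))).add ((t.xa.x1.sc 2).add (t.xa.xa.sc (-3)))

def sh1 : Q1 → T
  | [] => ⟨[], [], []⟩
  | c :: cs => T.add ⟨[[[c]]], [], []⟩ (sh1 cs).m1
def sh2 : Q2 → T
  | [] => ⟨[], [], []⟩
  | c :: cs => T.add (sh1 c) (sh2 cs).m2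
def sh3 : Q3 → T
  | [] => ⟨[], [], []⟩
  | c :: cs => T.add (sh2 c) (sh3 cs).m3

def hor : List (Int × Q3) → T
  | [] => ⟨[], [], []⟩
  | c :: cs => T.add ((sh3 c.2).sc c.1) (hor cs).mD

def tr (t : T) : Q3 :=
  add3 (add3 (sc3 3 t.q0) (x1 t.q1)) (add3 (x1 (x1 t.q2)) (sc3 (-2) (x2 t.q2)))

def chk (l : List (Int × Q3)) (p : Q3) : Bool :=
  isZ (add3 (tr (hor l).xa) (sc3 (-1) (x1 p)))

section
variable (a : ℚ)

theorem evT_add (s t : T) : evT e1 e2 e3 a (s.add t) = evT e1 e2 e3 a s + evT e1 e2 e3 a t := by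
  simp only [evT, T.add, ev3_add]; ring
theorem evT_sc (k : Int) (t : T) : evT e1 e2 e3 a (t.sc k) = k * evT e1 e2 e3 a t := by
  simp only [evT, T.sc, ev3_sc]; ring
theorem evT_x1 (t : T) : evT e1 e2 e3 a t.x1 = e1 * evT e1 e2 e3 a t := by
  simp only [evT, T.x1, ev3_x1]; ring
theorem evT_x2 (t : T) : evT e1 e2 e3 a t.x2 = e2 * evT e1 e2 e3 a t := by
  simp only [evT, T.x2, ev3_x2]; ring
theorem evT_x3 (t : T) : evT e1 e2 e3 a t.x3 = e3 * evT e1 e2 e3 a t := by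
  simp only [evT, T.x3, ev3_x3]; ring

theorem evT_xa (ha : a ^ 3 = e1 * a ^ 2 - e2 * a + e3) (t : T) :
    evT e1 e2 e3 a t.xa = a * evT e1 e2 e3 a t := by
  simp only [evT, T.xa, ev3_x1, ev3_x2, ev3_x3, ev3_add, ev3_sc]
  push_cast
  linear_combination (- ev3 e1 e2 e3 t.q2) * ha

theorem evT_m1 (t : T) : evT e1 e2 e3 a t.m1 = (e1 - 1) * evT e1 e2 e3 a t := by
  simp only [T.m1, evT_add, evT_sc, evT_x1]; push_cast; ring
theorem evT_m2 (ha : a ^ 3 = e1 * a ^ 2 - e2 * a + e3) (t : T) :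
    evT e1 e2 e3 a t.m2 = (e2 - e1 + a) * evT e1 e2 e3 a t := by
  simp only [T.m2, evT_add, evT_sc, evT_x1, evT_x2, evT_xa e1 e2 e3 a ha]; push_cast; ring
theorem evT_m3 (ha : a ^ 3 = e1 * a ^ 2 - e2 * a + e3) (t : T) :
    evT e1 e2 e3 a t.m3 = (e3 - e2 + a * e1 - a ^ 2) * evT e1 e2 e3 a t := by
  simp only [T.m3, evT_add, evT_sc, evT_x1, evT_x2, evT_x3, evT_xa e1 e2 e3 a ha]
  push_cast; ring
theorem evT_mD (ha : a ^ 3 = e1 * a ^ 2 - e2 * a + e3) (t : T) :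
    evT e1 e2 e3 a t.mD
      = (e1 ^ 2 - 4 * e2 + 2 * a * e1 - 3 * a ^ 2) * evT e1 e2 e3 a t := by
  simp only [T.mD, evT_add, evT_sc, evT_x1, evT_x2, evT_xa e1 e2 e3 a ha]
  push_cast; ring

theorem evT_nil : evT e1 e2 e3 a ⟨[], [], []⟩ = 0 := by
  simp [evT, ev3, lev]

theorem evT_sh1 : ∀ p : Q1, evT e1 e2 e3 a (sh1 p) = ev1 (e1 - 1) p
  | [] => by simp [sh1, evT_nil, ev1, lev]
  | c :: cs => by
      have h := evT_sh1 cs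
      simp only [ev1] at h
      simp only [sh1, evT_add, evT_m1, ev1, lev, h]
      simp [evT, ev3, ev2, ev1, lev]

theorem evT_sh2 (ha : a ^ 3 = e1 * a ^ 2 - e2 * a + e3) :
    ∀ p : Q2, evT e1 e2 e3 a (sh2 p) = ev2 (e1 - 1) (e2 - e1 + a) p
  | [] => by simp [sh2, evT_nil, ev2, lev]
  | c :: cs => by
      have h := evT_sh2 ha cs
      simp only [ev2] at h
      simp only [sh2, evT_add, evT_m2 e1 e2 e3 a ha, ev2, lev, h, evT_sh1]

theorem evT_sh3 (ha : a ^ 3 = e1 * a ^ 2 - e2 * a + e3) :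
    ∀ p : Q3, evT e1 e2 e3 a (sh3 p)
      = ev3 (e1 - 1) (e2 - e1 + a) (e3 - e2 + a * e1 - a ^ 2) p
  | [] => by simp [sh3, evT_nil, ev3, lev]
  | c :: cs => by
      have h := evT_sh3 ha cs
      simp only [ev3] at h
      simp only [sh3, evT_add, evT_m3 e1 e2 e3 a ha, ev3, lev, h, evT_sh2 e1 e2 e3 a ha]

end

/-- Evaluation of a symmetric polynomial at `(a, b, c)`. -/
def evS (p : Q3) (a b c : ℚ) : ℚ := ev3 (a + b + c) (a * b + b * c + c * a) (a * b * c) p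

/-- The Horner sum in `(b - c)^2`. -/
def horS (a b c : ℚ) : List (Int × Q3) → ℚ
  | [] => 0
  | p :: l => p.1 * evS p.2 (a - 1) b c + (b - c) ^ 2 * horS a b c l

theorem evT_hor (a b c : ℚ) : ∀ l : List (Int × Q3),
    evT (a + b + c) (a * b + b * c + c * a) (a * b * c) a (hor l) = horS a b c l
  | [] => by simp [hor, horS, evT_nil]
  | p :: l => by
      have ha : a ^ 3 = (a + b + c) * a ^ 2 - (a * b + b * c + c * a) * a + a * b * c := by ring
      simp only [hor, horS, evT_add, evT_sc, evT_mD _ _ _ a ha, evT_sh3 _ _ _ a ha, evT_hor a b c l,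
        evS]
      congr 2
      · congr 1 <;> ring
      · ring

theorem evS_rot (p : Q3) (a b c : ℚ) : evS p b c a = evS p a b c := by
  unfold evS; congr 1 <;> ring

theorem ev_tr (a b c : ℚ) (t : T) :
    evS (tr t) a b c =
      evT (a + b + c) (a * b + b * c + c * a) (a * b * c) a t +
      evT (a + b + c) (a * b + b * c + c * a) (a * b * c) b t +
      evT (a + b + c) (a * b + b * c + c * a) (a * b * c) c t := by
  simp only [evS, tr, evT, ev3_add, ev3_sc, ev3_x1, ev3_x2]
  push_cast; ring

theorem chk_sound (l : List (Int × Q3)) (p : Q3) (h : chk l p = true) (a b c : ℚ) :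
    (a + b + c) * evS p a b c
      = a * horS a b c l + b * horS b c a l + c * horS c a b l := by
  have h0 := ev3_isZ (a + b + c) (a * b + b * c + c * a) (a * b * c) _ h
  rw [ev3_add, ev3_sc, ev3_x1] at h0
  have h1 := ev_tr a b c (hor l).xa
  rw [evT_xa _ _ _ a (by ring), evT_xa _ _ _ b (by ring), evT_xa _ _ _ c (by ring),
    evT_hor a b c] at h1
  have h2 := evT_hor b c a l
  have h3 := evT_hor c a b l
  rw [show b + c + a = a + b + c by ring, show b * c + c * a + a * b = a * b + b * c + c * a by ring,
    show b * c * a = a * b * c by ring] at h2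
  rw [show c + a + b = a + b + c by ring, show c * a + a * b + b * c = a * b + b * c + c * a by ring,
    show c * a * b = a * b * c by ring] at h3
  rw [h2, h3] at h1
  simp only [evS] at h1 ⊢
  rw [h1] at h0
  push_cast at h0
  linarith

/-! ### The tables: `N_r / d_r` is the `r`-th moment of the area as a polynomial in `e1, e2, e3` -/

def N0 : Q3 :=
  [[[1]]]

def N2 : Q3 :=
  [[[], [1, 1]],
      [[-9]]]

def N4 : Q3 :=
  [[[], [0, -2, -4, -2], [7, 12, 5]],
      [[-30, 36, 66], [-252, -90]],
      [[405]]]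

def N6 : Q3 :=
  [[[], [0, -8, 0, 40, 48, 16], [0, -82, -198, -158, -42], [93, 205, 147, 35]],
      [[-1080, 1536, 1624, -2160, -1168], [-7182, 6552, 9666, 1764], [-16389, -5670, -945]],
      [[3726, -2916, -12474], [39123, 8505]],
      [[-25515]]]

def N8 : Q3 :=
  [[[], [0, -96, 0, 336, 0, -672, -576, -144], [0, -496, -76, 2480, 3704, 2048, 404], [0, -2060,
     -5576, -5584, -2488, -420], [1143, 2912, 2714, 1120, 175]],
      [[-88992, 147456, 76464, -215040, 3744, 77376, 18576], [-526608, 750360, 359648, -533104,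
     -277424, -31784], [-1205172, 927864, 1070136, 218232, 21420], [-1242432, -351828, -60480,
     -6300]],
      [[-63180, 147312, -416520, 304560, 301716], [996624, -867996, -2043144, -283500],
     [3382074, 816480, 85050]],
      [[154548, -87480, 1122660], [-3265920, -510300]],
      [[1148175]]]

def N10 : Q3 :=
  [[[], [0, -1152, 0, 3840, 0, -5376, 0, 5760, 3840, 768], [0, -4896, -704, 15152, 2288, -30304,
     -33856, -14512, -2288], [0, -10304, -3124, 50572, 86520, 60728, 20284, 2684], [0, -23404,
     -68516, -78728, -45144, -13068, -1540], [7665, 21481, 23430, 12694, 3465, 385]],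
      [[-7546752, 14155776, 2343168, -18690048, 7138560, 5627904, -1861248, -1174272, -154368],
     [-41162976, 73106304, -176880, -52909664, 4562528, 14554560, 3797296, 293216], [-86331456,
     117499752, 33529900, -56256672, -25210232, -3435432, -229460], [-98243028, 69430992,
     65399688, 12388992, 1381644, 92400], [-57983121, -14490828, -2075634, -235620, -17325]],
      [[-16244928, 31237056, -21932688, 10699776, 6601344, -9023616, -3534960], [-1139508,
     -18841356, -49098888, 56546712, 40935708, 4010292], [103634964, -97615044, -146740572,
     -24709212, -1746360], [169804998, 39066786, 4677750, 311850]],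
      [[47611476, -43386192, 8235432, -5260464, -19463004], [21068100, 18283320, 118392516,
     13471920], [-192728646, -37047780, -2806650]],
      [[-31659012, 14434200, -37047780], [103565385, 12629925]],
      [[-22733865]]]

def N12 : Q3 :=
  [[[], [0, -5306880, 0, 17512704, 0, -23350272, 0, 17512704, 0, -11675136, -6368256, -1061376],
     [0, -20657664, -2476864, 58336896, 8126560, -72348864, -10736544, 79448064, 71810080,
     25272384, 3327584], [0, -35851488, -10048480, 101748360, 28632240, -198243912, -259963200,
     -143603976, -38823824, -4252248], [0, -41380080, -18580380, 197655600, 374673860,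
     304146288, 131399372, 29933904, 2862860], [0, -59030106, -183291700, -231500310,
     -154930360, -58672614, -12032020, -1051050], [12730293, 38231028, 46399613, 29717688,
     10745735, 2102100, 175175]],
      [[-256338224640, 529152344064, -37155019008, -618421321728, 404429540352, 96335659008,
     -125834492160, -10665050112, 14750664192, 3757575168, 306737664], [-1334389510656,
     2692977478272, -764321382144, -1587084979904, 825949865088, 367053053760, -138933669120,
     -75328612416, -11615827584, -633850048], [-2595227291424, 4472560824768, -624779785656,
     -2166469805872, 267652509336, 490485036896, 119286631992, 11498743568, 555506952],
     [-2742773261328, 3583530899640, 671100111840, -1315373501792, -519177289680, -69820767848,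
     -5578180608, -266105840], [-1855012542534, 1249217299476, 1010084523534, 179339465448,
     18621152550, 1443782340, 72522450], [-711570295908, -166633770186, -20985708744,
     -2024322300, -170270100, -9459450]],
      [[-660801478464, 1412434032768, -877879030176, 139795300416, 108168442976, -175786040064,
     24243201056, 47006844480, 9425388128], [-983863975392, 912528704232, -540261543600,
     1057410345096, 24968309184, -504044002728, -170294692464, -12208492296], [371193054948,
     -1885113333072, -980880691392, 1853563630896, 1009412352468, 124371767520, 6519993480],
     [2304161878464, -2274633830340, -2502579284712, -424164548808, -37274557320, -1759457700],
     [2202501891213, 485845784424, 55972646730, 4427022600, 212837625]],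
      [[1503655981128, -1638950999760, -107968066776, 412660212768, -86803820424, 88031120112,
     70305010776], [2662230411072, -1540964807280, -16755188256, -568919523744, -700975731456,
     -61044263280], [436545993996, 1086851700792, 2394480200112, 353218025160, 19921601700],
     [-2757202215768, -546931885500, -52102650600, -2554051500]],
      [[-900109074996, 642170909520, 269760075624, -83539375920, 196486830540], [-1358868970368,
     135226080990, -1115565911460, -108036378450], [1793830773735, 289629440100, 17239847625]],
      [[421440389370, -159591732300, 227565988650], [-620634514500, -62063451450]],
      [[93095177175]]]

theorem chk2 : chk [(1, N2), (3, N0)] N2 = true := by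
  decide +kernel

theorem chk4 : chk [(1, N4), (30, N2), (15, N0)] N4 = true := by
  decide +kernel

theorem chk6 : chk [(1, N6), (63, N4), (315, N2), (63, N0)] N6 = true := by
  decide +kernel

theorem chk8 : chk [(1, N8), (60, N6), (630, N4), (1260, N2), (135, N0)] N8 = true := by
  decide +kernel

theorem chk10 : chk [(1, N10), (33, N8), (330, N6), (1386, N4), (1485, N2), (99, N0)] N10 = true := by
  decide +kernel

theorem chk12 : chk [(1, N12), (8190, N10), (45045, N8), (180180, N6), (405405, N4), (270270, N2), (12285, N0)] N12 = true := by
  decide +kernel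

end GepAux

/-! ### Words, the area, and the Gepner statistic -/

namespace GepAux

/-- Number of pairs `j < k` with `w_j = y`, `w_k = z`. -/
def pr (y z : ℕ) : List ℕ → ℕ
  | [] => 0
  | x :: w => (if x = y then w.count z else 0) + pr y z w

def pairC (R : ℕ → ℕ → Bool) : List ℕ → ℕ
  | [] => 0
  | x :: w => w.countP (R x) + pairC R w

def tripC (Q : ℕ → ℕ → ℕ → Bool) : List ℕ → ℕ
  | [] => 0
  | x :: w => pairC (Q x) w + tripC Q w

theorem sum_countP (R : ℕ → Bool) : ∀ w : List ℕ,
    (∑ k : Fin w.length, if R (w.get k) then 1 else 0) = w.countP R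
  | [] => by simp
  | x :: w => by
      have := sum_countP R w
      rw [List.countP_cons, ← this]
      simp only [List.length_cons]
      rw [Fin.sum_univ_succ]
      by_cases h : R x = true <;> simp [h, add_comm]

theorem sum_pairC (R : ℕ → ℕ → Bool) : ∀ w : List ℕ,
    (∑ j : Fin w.length, ∑ k : Fin w.length,
      if j < k ∧ R (w.get j) (w.get k) then 1 else 0) = pairC R w
  | [] => by simp [pairC]
  | x :: w => by
      have := sum_pairC R w
      rw [pairC, ← this, ← sum_countP]
      simp only [List.length_cons]
      rw [Fin.sum_univ_succ]
      simp only [Fin.sum_univ_succ]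
      simp

theorem sum_tripC (Q : ℕ → ℕ → ℕ → Bool) : ∀ w : List ℕ,
    (∑ i : Fin w.length, ∑ j : Fin w.length, ∑ k : Fin w.length,
      if i < j ∧ j < k ∧ Q (w.get i) (w.get j) (w.get k) then 1 else 0) = tripC Q w
  | [] => by simp [tripC]
  | x :: w => by
      have := sum_tripC Q w
      rw [tripC, ← this, ← sum_pairC]
      simp only [List.length_cons]
      rw [Fin.sum_univ_succ]
      simp only [Fin.sum_univ_succ]
      simp

def Qodd (x y z : ℕ) : Bool :=
  decide ((x < z ∧ z < y) ∨ (y < x ∧ x < z) ∨ (z < y ∧ y < x))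

theorem gep_eq_tripC (w : List ℕ) : gep w = tripC Qodd w := by
  rw [← sum_tripC, gep, Finset.card_filter, Fintype.sum_prod_type]
  simp only [Fintype.sum_prod_type, Qodd, decide_eq_true_eq]

def Good (w : List ℕ) : Prop := ∀ x ∈ w, x = 1 ∨ x = 2 ∨ x = 3

theorem countP_eq (R : ℕ → Bool) (z : ℕ) (h : ∀ x, (x = 1 ∨ x = 2 ∨ x = 3) → (R x = true ↔ x = z))
    (w : List ℕ) (hw : Good w) : w.countP R = w.count z := by
  rw [List.count]
  apply List.countP_congr
  intro x hx
  rw [h x (hw x hx)]; simp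

theorem countP_zero (R : ℕ → Bool) (h : ∀ x, (x = 1 ∨ x = 2 ∨ x = 3) → ¬ R x = true)
    (w : List ℕ) (hw : Good w) : w.countP R = 0 := by
  rw [List.countP_eq_zero]
  intro x hx
  exact h x (hw x hx)

theorem pairC_eq (R : ℕ → ℕ → Bool) (y z : ℕ)
    (h : ∀ u v, (u = 1 ∨ u = 2 ∨ u = 3) → (v = 1 ∨ v = 2 ∨ v = 3) →
      (R u v = true ↔ u = y ∧ v = z)) :
    ∀ w : List ℕ, Good w → pairC R w = pr y z w
  | [], _ => rfl
  | x :: w, hw => by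
      have hx : x = 1 ∨ x = 2 ∨ x = 3 := hw x (by simp)
      have hw' : Good w := fun u hu => hw u (by simp [hu])
      rw [pairC, pr, pairC_eq R y z h w hw']
      congr 1
      split_ifs with hxy
      · exact countP_eq _ _ (fun v hv => by rw [h x v hx hv]; simp [hxy]) w hw'
      · exact countP_zero _ (fun v hv => by rw [h x v hx hv]; simp [hxy]) w hw'

theorem pr_add (y z : ℕ) (hyz : y ≠ z) : ∀ w : List ℕ,
    pr y z w + pr z y w = w.count y * w.count z
  | [] => by simp [pr]
  | x :: w => by
      have ih := pr_add y z hyz w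
      simp only [pr, List.count_cons, beq_iff_eq]
      by_cases h1 : x = y
      · have h2 : ¬ x = z := fun h => hyz (h1 ▸ h)
        have h3 : ¬ y = z := hyz
        simp only [h1, h3, if_true, if_false]; linarith
      · by_cases h2 : x = z
        · simp only [h2, Ne.symm hyz, if_true, if_false]; linarith
        · simp only [h1, h2, if_false]; linarith

/-- The (signed) area of a word. -/
def area (w : List ℕ) : ℚ :=
  ((pr 1 2 w : ℚ) - pr 2 1 w) + ((pr 2 3 w : ℚ) - pr 3 2 w) + ((pr 3 1 w : ℚ) - pr 1 3 w)

theorem two_gep : ∀ w : List ℕ, Good w →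
    2 * (gep w : ℚ) = (w.count 1 : ℚ) * w.count 2 * w.count 3
      - (w.count 3 * ((pr 1 2 w : ℚ) - pr 2 1 w) + w.count 1 * ((pr 2 3 w : ℚ) - pr 3 2 w)
        + w.count 2 * ((pr 3 1 w : ℚ) - pr 1 3 w))
  | [], _ => by simp [gep_eq_tripC, tripC]
  | x :: w, hw => by
      have hx : x = 1 ∨ x = 2 ∨ x = 3 := hw x (by simp)
      have hw' : Good w := fun u hu => hw u (by simp [hu])
      have ih := two_gep w hw'
      have h12 : (pr 1 2 w : ℚ) + pr 2 1 w = w.count 1 * w.count 2 := by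
        exact_mod_cast pr_add 1 2 (by norm_num) w
      have h23 : (pr 2 3 w : ℚ) + pr 3 2 w = w.count 2 * w.count 3 := by
        exact_mod_cast pr_add 2 3 (by norm_num) w
      have h31 : (pr 3 1 w : ℚ) + pr 1 3 w = w.count 3 * w.count 1 := by
        exact_mod_cast pr_add 3 1 (by norm_num) w
      rw [gep_eq_tripC] at ih ⊢
      rw [tripC]
      rcases hx with rfl | rfl | rfl
      · rw [pairC_eq (Qodd 1) 3 2 (by rintro u v (rfl | rfl | rfl) (rfl | rfl | rfl) <;> decide)
          w hw']
        simp only [pr, List.count_cons]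
        norm_num
        linear_combination ih + h23
      · rw [pairC_eq (Qodd 2) 1 3 (by rintro u v (rfl | rfl | rfl) (rfl | rfl | rfl) <;> decide)
          w hw']
        simp only [pr, List.count_cons]
        norm_num
        linear_combination ih + h31
      · rw [pairC_eq (Qodd 3) 2 1 (by rintro u v (rfl | rfl | rfl) (rfl | rfl | rfl) <;> decide)
          w hw']
        simp only [pr, List.count_cons]
        norm_num
        linear_combination ih + h12

theorem area_cons1 (w : List ℕ) : area (1 :: w) = area w + ((w.count 2 : ℚ) - w.count 3) := by
  simp [area, pr]; ring
theorem area_cons2 (w : List ℕ) : area (2 :: w) = area w + ((w.count 3 : ℚ) - w.count 1) := by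
  simp [area, pr]; ring
theorem area_cons3 (w : List ℕ) : area (3 :: w) = area w + ((w.count 1 : ℚ) - w.count 2) := by
  simp [area, pr]; ring

theorem pr_append_singleton (y z x : ℕ) : ∀ w : List ℕ,
    pr y z (w ++ [x]) = pr y z w + (if x = z then w.count y else 0)
  | [] => by simp [pr]
  | u :: w => by
      have ih := pr_append_singleton y z x w
      simp only [List.cons_append, pr, ih, List.count_append, List.count_cons, beq_iff_eq,
        List.count_nil]
      split_ifs <;> omega

theorem pr_reverse (y z : ℕ) : ∀ w : List ℕ, pr y z w.reverse = pr z y w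
  | [] => by simp [pr]
  | u :: w => by
      rw [List.reverse_cons, pr_append_singleton, pr_reverse y z w, pr, List.count_reverse]
      omega

theorem area_reverse (w : List ℕ) : area w.reverse = - area w := by
  simp only [area, pr_reverse]; ring

theorem mem_W (a b c : ℕ) (w : List ℕ) :
    w ∈ W a b c ↔ Good w ∧ w.count 1 = a ∧ w.count 2 = b ∧ w.count 3 = c := by
  rw [W, List.mem_toFinset, List.mem_permutations]
  constructor
  · intro h
    refine ⟨?_, ?_, ?_, ?_⟩
    · intro x hx
      have := h.mem_iff.1 hx
      simp only [List.mem_append, List.mem_replicate] at this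
      tauto
    all_goals
      rw [h.count_eq]; simp [List.count_replicate]
  · rintro ⟨hg, h1, h2, h3⟩
    rw [List.perm_iff_count]
    intro x
    simp only [List.count_append, List.count_replicate, beq_iff_eq]
    by_cases hx : x ∈ w
    · rcases hg x hx with rfl | rfl | rfl <;> simp [h1, h2, h3]
    · have h0 : w.count x = 0 := List.count_eq_zero.2 hx
      rw [h0]
      split_ifs with k1 k2 k3 <;> subst_vars <;> omega

theorem good_cons (x : ℕ) (w : List ℕ) : Good (x :: w) ↔ (x = 1 ∨ x = 2 ∨ x = 3) ∧ Good w := by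
  simp [Good]

/-- Splitting words by the first letter. -/
theorem sum_W (a b c : ℕ) (h : a + b + c ≠ 0) (f : List ℕ → ℚ) :
    ∑ w ∈ W a b c, f w =
      (if a = 0 then 0 else ∑ w ∈ W (a - 1) b c, f (1 :: w)) +
      (if b = 0 then 0 else ∑ w ∈ W a (b - 1) c, f (2 :: w)) +
      (if c = 0 then 0 else ∑ w ∈ W a b (c - 1), f (3 :: w)) := by
  have key : W a b c =
      ((if a = 0 then ∅ else (W (a - 1) b c).image (List.cons 1)) ∪
      (if b = 0 then ∅ else (W a (b - 1) c).image (List.cons 2))) ∪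
      (if c = 0 then ∅ else (W a b (c - 1)).image (List.cons 3)) := by
    ext w
    have im : ∀ (p : Prop) [Decidable p] (s : Finset (List ℕ)),
        w ∈ (if p then ∅ else s) ↔ ¬ p ∧ w ∈ s := by
      intro p _ s; split_ifs <;> simp [*]
    simp only [Finset.mem_union, im, Finset.mem_image, mem_W]
    cases w with
    | nil => simp; omega
    | cons x w =>
      simp only [good_cons, List.count_cons, List.cons.injEq, beq_iff_eq]
      constructor
      · rintro ⟨⟨rfl | rfl | rfl, hg⟩, h1, h2, h3⟩
        · left; left; norm_num at h1 h2 h3; exact ⟨by omega, w, ⟨hg, by omega, h2, h3⟩, rfl, rfl⟩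
        · left; right; norm_num at h1 h2 h3; exact ⟨by omega, w, ⟨hg, h1, by omega, h3⟩, rfl, rfl⟩
        · right; norm_num at h1 h2 h3; exact ⟨by omega, w, ⟨hg, h1, h2, by omega⟩, rfl, rfl⟩
      · rintro ((⟨h0, w', ⟨hg, h1, h2, h3⟩, rfl, rfl⟩ | ⟨h0, w', ⟨hg, h1, h2, h3⟩, rfl, rfl⟩) |
          ⟨h0, w', ⟨hg, h1, h2, h3⟩, rfl, rfl⟩) <;>
        · norm_num
          exact ⟨hg, by omega, by omega, by omega⟩
  have si : ∀ (x : ℕ) (p : Prop) [Decidable p] (s : Finset (List ℕ)),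
      ∑ w ∈ (if p then ∅ else s.image (List.cons x)), f w
        = if p then 0 else ∑ w ∈ s, f (x :: w) := by
    intro x p _ s
    split_ifs
    · simp
    · exact Finset.sum_image (fun u _ v _ huv => by simpa using huv)
  have hd : ∀ (x : ℕ) (p : Prop) [Decidable p] (s : Finset (List ℕ)) (w : List ℕ),
      w ∈ (if p then ∅ else s.image (List.cons x)) → w.head? = some x := by
    intro x p _ s w hw
    split_ifs at hw
    · simp at hw
    · rw [Finset.mem_image] at hw
      obtain ⟨u, _, rfl⟩ := hw
      rfl
  rw [key, Finset.sum_union, Finset.sum_union, si, si, si]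
  · rw [Finset.disjoint_left]
    intro w h1 h2
    have := hd _ _ _ _ h1
    have := hd _ _ _ _ h2
    simp_all
  · rw [Finset.disjoint_left]
    intro w h1 h2
    have k2 := hd _ _ _ _ h2
    rcases Finset.mem_union.1 h1 with h1 | h1
    · have := hd _ _ _ _ h1
      simp_all
    · have := hd _ _ _ _ h1
      simp_all

/-- Power sums of the area. -/
def M (r a b c : ℕ) : ℚ := ∑ w ∈ W a b c, area w ^ r

theorem M_odd (r a b c : ℕ) (hr : Odd r) : M r a b c = 0 := by
  have h : M r a b c = - M r a b c := by
    unfold M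
    rw [← Finset.sum_neg_distrib]
    refine Finset.sum_bij' (fun w _ => w.reverse) (fun w _ => w.reverse) ?_ ?_ ?_ ?_ ?_
    · intro w hw
      rw [mem_W] at hw ⊢
      simpa [Good] using hw
    · intro w hw
      rw [mem_W] at hw ⊢
      simpa [Good] using hw
    · simp
    · simp
    · intro w _
      rw [area_reverse, hr.neg_pow, neg_neg]
  linarith

theorem sum_shift (r a b c : ℕ) (d : ℚ) :
    ∑ w ∈ W a b c, (area w + d) ^ r
      = ∑ k ∈ Finset.range (r + 1), d ^ (r - k) * (r.choose k : ℚ) * M k a b c := by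
  simp only [add_pow, M, Finset.mul_sum]
  rw [Finset.sum_comm]
  refine Finset.sum_congr rfl fun k _ => Finset.sum_congr rfl fun w _ => by ring

/-- Sum of shifted powers. -/
def MS (r a b c : ℕ) (d : ℚ) : ℚ := ∑ w ∈ W a b c, (area w + d) ^ r

theorem M_rec (r a b c : ℕ) (h : a + b + c ≠ 0) :
    M r a b c =
      (if a = 0 then 0 else MS r (a - 1) b c (b - c)) +
      (if b = 0 then 0 else MS r a (b - 1) c (c - a)) +
      (if c = 0 then 0 else MS r a b (c - 1) (a - b)) := by
  rw [M, sum_W a b c h]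
  congr 1
  · congr 1
    · congr 1
      refine Finset.sum_congr rfl fun w hw => ?_
      obtain ⟨_, h1, h2, h3⟩ := (mem_W _ _ _ _).1 hw
      rw [area_cons1, h2, h3]
    · congr 1
      refine Finset.sum_congr rfl fun w hw => ?_
      obtain ⟨_, h1, h2, h3⟩ := (mem_W _ _ _ _).1 hw
      rw [area_cons2, h1, h3]
  · congr 1
    refine Finset.sum_congr rfl fun w hw => ?_
    obtain ⟨_, h1, h2, h3⟩ := (mem_W _ _ _ _).1 hw
    rw [area_cons3, h1, h2]

/-- The multinomial coefficient. -/
def mult (a b c : ℕ) : ℚ := ((a + b + c).factorial : ℚ) / (a.factorial * b.factorial * c.factorial)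

theorem mult_pos (a b c : ℕ) : 0 < mult a b c := by
  unfold mult; positivity

theorem mult_a (a b c : ℕ) : ((a + 1 : ℕ) + b + c : ℚ) * mult a b c = (a + 1 : ℕ) * mult (a + 1) b c := by
  unfold mult
  rw [show a + 1 + b + c = (a + b + c) + 1 by ring, Nat.factorial_succ, Nat.factorial_succ]
  push_cast
  have := Nat.factorial_ne_zero a
  field_simp
  ring
theorem mult_b (a b c : ℕ) : (a + (b + 1 : ℕ) + c : ℚ) * mult a b c = (b + 1 : ℕ) * mult a (b + 1) c := by
  unfold mult
  rw [show a + (b + 1) + c = (a + b + c) + 1 by ring, Nat.factorial_succ, Nat.factorial_succ]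
  push_cast
  field_simp
  ring
theorem mult_c (a b c : ℕ) : (a + b + (c + 1 : ℕ) : ℚ) * mult a b c = (c + 1 : ℕ) * mult a b (c + 1) := by
  unfold mult
  rw [show a + b + (c + 1) = (a + b + c) + 1 by ring, Nat.factorial_succ, Nat.factorial_succ]
  push_cast
  field_simp
  ring

/-- One step of the induction: if the shifted sums are `mult * F`, with `F` solving the recurrence. -/
theorem M_step (r : ℕ) (p : ℚ → ℚ → ℚ → ℚ) (G : ℚ → ℚ → ℚ → ℚ)
    (hp0 : p 0 0 0 = M r 0 0 0)
    (hrec : ∀ a b c, (a + b + c) * p a b c = a * G a b c + b * G b c a + c * G c a b)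
    (hG : ∀ a b c : ℕ, ∀ x y z : ℚ, (M r a b c = mult a b c * p a b c) →
      ((x = a + 1 ∧ y = b ∧ z = c) ∨ (x = b + 1 ∧ y = c ∧ z = a) ∨ (x = c + 1 ∧ y = a ∧ z = b)) →
      MS r a b c (y - z) = mult a b c * G x y z) :
    ∀ N a b c : ℕ, a + b + c = N → M r a b c = mult a b c * p a b c := by
  intro N
  induction N with
  | zero =>
    intro a b c h
    obtain ⟨rfl, rfl, rfl⟩ : a = 0 ∧ b = 0 ∧ c = 0 := by omega
    simp [mult, hp0]
  | succ N ih =>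
    intro a b c h
    have hN : (a + b + c : ℚ) ≠ 0 := by
      have : (a + b + c : ℚ) = (N + 1 : ℕ) := by exact_mod_cast h
      rw [this]; positivity
    apply mul_left_cancel₀ hN
    rw [M_rec r a b c (by omega)]
    have t1 : (a + b + c : ℚ) * (if a = 0 then 0 else MS r (a - 1) b c (b - c))
        = mult a b c * (a * G a b c) := by
      rcases a with _ | a
      · simp
      · simp only [Nat.succ_ne_zero, if_false, Nat.add_sub_cancel]
        rw [hG a b c (a + 1) b c (ih a b c (by omega)) (by simp), ← mul_assoc, mult_a]
        push_cast; ring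
    have t2 : (a + b + c : ℚ) * (if b = 0 then 0 else MS r a (b - 1) c (c - a))
        = mult a b c * (b * G b c a) := by
      rcases b with _ | b
      · simp
      · simp only [Nat.succ_ne_zero, if_false, Nat.add_sub_cancel]
        rw [hG a b c (b + 1) c a (ih a b c (by omega)) (by simp), ← mul_assoc, mult_b]
        push_cast; ring
    have t3 : (a + b + c : ℚ) * (if c = 0 then 0 else MS r a b (c - 1) (a - b))
        = mult a b c * (c * G c a b) := by
      rcases c with _ | c
      · simp
      · simp only [Nat.succ_ne_zero, if_false, Nat.add_sub_cancel]
        rw [hG a b c (c + 1) a b (ih a b c (by omega)) (by simp), ← mul_assoc, mult_c]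
        push_cast; ring
    rw [mul_add, mul_add, t1, t2, t3]
    linear_combination (- mult a b c) * hrec a b c

end GepAux

/-! ### The moments -/

namespace GepAux

theorem W_zero : W 0 0 0 = {[]} := by
  simp [W]

theorem M_zero (r : ℕ) (hr : r ≠ 0) : M r 0 0 0 = 0 := by
  simp [M, W_zero, area, pr, hr]

theorem M0 : ∀ a b c : ℕ, M 0 a b c = mult a b c * (evS N0 a b c / 1) := by
  have e : ∀ a b c : ℚ, evS N0 a b c = 1 := by
    intro a b c; simp [evS, N0, ev3, ev2, ev1, lev]
  intro a b c
  refine M_step 0 (fun a b c => evS N0 a b c / 1) (fun _ _ _ => 1) ?_ ?_ ?_ (a + b + c) a b c rfl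
  · simp [e, M, W_zero]
  · intro a b c; simp only [e]; ring
  · intro a b c x y z h _
    simp only [e] at h
    simpa [M, MS] using h

theorem M2 : ∀ a b c : ℕ, M 2 a b c = mult a b c * (evS N2 a b c / 3) := by
  intro a b c
  refine M_step 2 (fun a b c => evS N2 a b c / 3)
    (fun a b c => horS a b c [(1, N2), (3, N0)] / 3)
    ?_ ?_ ?_ (a + b + c) a b c rfl
  · rw [M_zero _ (by norm_num)]; simp [evS, N2, ev3, ev2, ev1, lev]
  · intro a b c
    have h := chk_sound _ _ chk2 a b c
    linear_combination h / 3
  · intro a b c x y z h hx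
    have e : ∀ p : Q3, evS p (x - 1) y z = evS p a b c := by
      intro p
      rcases hx with ⟨rfl, rfl, rfl⟩ | ⟨rfl, rfl, rfl⟩ | ⟨rfl, rfl, rfl⟩
      · rw [add_sub_cancel_right]
      · rw [add_sub_cancel_right, evS_rot]
      · rw [add_sub_cancel_right, evS_rot, evS_rot]
    simp only [horS, e]
    rw [MS, sum_shift]
    simp only [Finset.sum_range_succ, Finset.sum_range_zero, h,
      M0, M_odd 1 a b c (by decide)]
    norm_num [Nat.choose]
    ring

theorem M4 : ∀ a b c : ℕ, M 4 a b c = mult a b c * (evS N4 a b c / 15) := by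
  intro a b c
  refine M_step 4 (fun a b c => evS N4 a b c / 15)
    (fun a b c => horS a b c [(1, N4), (30, N2), (15, N0)] / 15)
    ?_ ?_ ?_ (a + b + c) a b c rfl
  · rw [M_zero _ (by norm_num)]; simp [evS, N4, ev3, ev2, ev1, lev]
  · intro a b c
    have h := chk_sound _ _ chk4 a b c
    linear_combination h / 15
  · intro a b c x y z h hx
    have e : ∀ p : Q3, evS p (x - 1) y z = evS p a b c := by
      intro p
      rcases hx with ⟨rfl, rfl, rfl⟩ | ⟨rfl, rfl, rfl⟩ | ⟨rfl, rfl, rfl⟩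
      · rw [add_sub_cancel_right]
      · rw [add_sub_cancel_right, evS_rot]
      · rw [add_sub_cancel_right, evS_rot, evS_rot]
    simp only [horS, e]
    rw [MS, sum_shift]
    simp only [Finset.sum_range_succ, Finset.sum_range_zero, h,
      M0, M2, M_odd 1 a b c (by decide), M_odd 3 a b c (by decide)]
    norm_num [Nat.choose]
    ring

theorem M6 : ∀ a b c : ℕ, M 6 a b c = mult a b c * (evS N6 a b c / 63) := by
  intro a b c
  refine M_step 6 (fun a b c => evS N6 a b c / 63)
    (fun a b c => horS a b c [(1, N6), (63, N4), (315, N2), (63, N0)] / 63)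
    ?_ ?_ ?_ (a + b + c) a b c rfl
  · rw [M_zero _ (by norm_num)]; simp [evS, N6, ev3, ev2, ev1, lev]
  · intro a b c
    have h := chk_sound _ _ chk6 a b c
    linear_combination h / 63
  · intro a b c x y z h hx
    have e : ∀ p : Q3, evS p (x - 1) y z = evS p a b c := by
      intro p
      rcases hx with ⟨rfl, rfl, rfl⟩ | ⟨rfl, rfl, rfl⟩ | ⟨rfl, rfl, rfl⟩
      · rw [add_sub_cancel_right]
      · rw [add_sub_cancel_right, evS_rot]
      · rw [add_sub_cancel_right, evS_rot, evS_rot]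
    simp only [horS, e]
    rw [MS, sum_shift]
    simp only [Finset.sum_range_succ, Finset.sum_range_zero, h,
      M0, M2, M4, M_odd 1 a b c (by decide), M_odd 3 a b c (by decide), M_odd 5 a b c (by decide)]
    norm_num [Nat.choose]
    ring

theorem M8 : ∀ a b c : ℕ, M 8 a b c = mult a b c * (evS N8 a b c / 135) := by
  intro a b c
  refine M_step 8 (fun a b c => evS N8 a b c / 135)
    (fun a b c => horS a b c [(1, N8), (60, N6), (630, N4), (1260, N2), (135, N0)] / 135)
    ?_ ?_ ?_ (a + b + c) a b c rfl
  · rw [M_zero _ (by norm_num)]; simp [evS, N8, ev3, ev2, ev1, lev]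
  · intro a b c
    have h := chk_sound _ _ chk8 a b c
    linear_combination h / 135
  · intro a b c x y z h hx
    have e : ∀ p : Q3, evS p (x - 1) y z = evS p a b c := by
      intro p
      rcases hx with ⟨rfl, rfl, rfl⟩ | ⟨rfl, rfl, rfl⟩ | ⟨rfl, rfl, rfl⟩
      · rw [add_sub_cancel_right]
      · rw [add_sub_cancel_right, evS_rot]
      · rw [add_sub_cancel_right, evS_rot, evS_rot]
    simp only [horS, e]
    rw [MS, sum_shift]
    simp only [Finset.sum_range_succ, Finset.sum_range_zero, h,
      M0, M2, M4, M6, M_odd 1 a b c (by decide), M_odd 3 a b c (by decide), M_odd 5 a b c (by decide), M_odd 7 a b c (by decide)]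
    norm_num [Nat.choose]
    ring

theorem M10 : ∀ a b c : ℕ, M 10 a b c = mult a b c * (evS N10 a b c / 99) := by
  intro a b c
  refine M_step 10 (fun a b c => evS N10 a b c / 99)
    (fun a b c => horS a b c [(1, N10), (33, N8), (330, N6), (1386, N4), (1485, N2), (99, N0)] / 99)
    ?_ ?_ ?_ (a + b + c) a b c rfl
  · rw [M_zero _ (by norm_num)]; simp [evS, N10, ev3, ev2, ev1, lev]
  · intro a b c
    have h := chk_sound _ _ chk10 a b c
    linear_combination h / 99
  · intro a b c x y z h hx
    have e : ∀ p : Q3, evS p (x - 1) y z = evS p a b c := by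
      intro p
      rcases hx with ⟨rfl, rfl, rfl⟩ | ⟨rfl, rfl, rfl⟩ | ⟨rfl, rfl, rfl⟩
      · rw [add_sub_cancel_right]
      · rw [add_sub_cancel_right, evS_rot]
      · rw [add_sub_cancel_right, evS_rot, evS_rot]
    simp only [horS, e]
    rw [MS, sum_shift]
    simp only [Finset.sum_range_succ, Finset.sum_range_zero, h,
      M0, M2, M4, M6, M8, M_odd 1 a b c (by decide), M_odd 3 a b c (by decide), M_odd 5 a b c (by decide), M_odd 7 a b c (by decide), M_odd 9 a b c (by decide)]
    norm_num [Nat.choose]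
    ring

theorem M12 : ∀ a b c : ℕ, M 12 a b c = mult a b c * (evS N12 a b c / 12285) := by
  intro a b c
  refine M_step 12 (fun a b c => evS N12 a b c / 12285)
    (fun a b c => horS a b c [(1, N12), (8190, N10), (45045, N8), (180180, N6), (405405, N4), (270270, N2), (12285, N0)] / 12285)
    ?_ ?_ ?_ (a + b + c) a b c rfl
  · rw [M_zero _ (by norm_num)]; simp [evS, N12, ev3, ev2, ev1, lev]
  · intro a b c
    have h := chk_sound _ _ chk12 a b c
    linear_combination h / 12285
  · intro a b c x y z h hx
    have e : ∀ p : Q3, evS p (x - 1) y z = evS p a b c := by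
      intro p
      rcases hx with ⟨rfl, rfl, rfl⟩ | ⟨rfl, rfl, rfl⟩ | ⟨rfl, rfl, rfl⟩
      · rw [add_sub_cancel_right]
      · rw [add_sub_cancel_right, evS_rot]
      · rw [add_sub_cancel_right, evS_rot, evS_rot]
    simp only [horS, e]
    rw [MS, sum_shift]
    simp only [Finset.sum_range_succ, Finset.sum_range_zero, h,
      M0, M2, M4, M6, M8, M10, M_odd 1 a b c (by decide), M_odd 3 a b c (by decide), M_odd 5 a b c (by decide), M_odd 7 a b c (by decide), M_odd 9 a b c (by decide), M_odd 11 a b c (by decide)]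
    norm_num [Nat.choose]
    ring

theorem card_W (a b c : ℕ) : ((W a b c).card : ℚ) = mult a b c := by
  have h := M0 a b c
  have e : evS N0 a b c = 1 := by simp [evS, N0, ev3, ev2, ev1, lev]
  rw [e] at h
  simpa [M] using h

end GepAux

theorem gep_words_twelfth_central_moment (n : ℕ) (hn : 1 ≤ n) :
    (∑ w ∈ W n n n, ((gep w : ℚ) - (n : ℚ) ^ 3 / 2) ^ 12) / ((W n n n).card : ℚ) =
      (n : ℚ) ^ 15 *
        ((343717911 / 1863680) * (n : ℚ) ^ 9 - (265635477 / 116480) * (n : ℚ) ^ 8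
          + (93771627 / 7280) * (n : ℚ) ^ 7 - (45012561 / 1040) * (n : ℚ) ^ 6
          + (43093563 / 455) * (n : ℚ) ^ 5 - (77940021 / 560) * (n : ℚ) ^ 4
          + (62196357 / 455) * (n : ℚ) ^ 3 - (39213532 / 455) * (n : ℚ) ^ 2
          + (14354176 / 455) * (n : ℚ) - 463661 / 91) := by
  have h1 : ∀ w ∈ W n n n, ((gep w : ℚ) - (n : ℚ) ^ 3 / 2) ^ 12
      = (n : ℚ) ^ 12 / 4096 * GepAux.area w ^ 12 := by
    intro w hw
    obtain ⟨hg, k1, k2, k3⟩ := (GepAux.mem_W _ _ _ _).1 hw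
    have h := GepAux.two_gep w hg
    rw [k1, k2, k3] at h
    have h' : (gep w : ℚ) - (n : ℚ) ^ 3 / 2 = - (n : ℚ) / 2 * GepAux.area w := by
      rw [GepAux.area]; linear_combination h / 2
    rw [h']; ring
  have h2 := GepAux.M12 n n n
  rw [GepAux.M] at h2
  rw [Finset.sum_congr rfl h1, ← Finset.mul_sum, h2, GepAux.card_W]
  have h3 := (GepAux.mult_pos n n n).ne'
  rw [← mul_assoc, mul_comm _ (GepAux.mult n n n), mul_assoc, mul_div_cancel_left₀ _ h3]
  simp only [GepAux.evS, GepAux.N12, GepAux.ev3, GepAux.ev2, GepAux.ev1, GepAux.lev]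
  push_cast
  ring
end
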